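/- Let α be irrational with 0 < α < 1 whose negative continued fraction partial quotients satisfy a_i ≤ M for all i and contain no block of N consecutive terms equal to 2, and set R = N/(N+1). Then there is an integer s₀ ≥ N such that for every integer s ≥ s₀, setting P₁ = R^{2s}/(1 − R^{s−N})² and P₂ = 1 − R^{s−N}, one has P₁ ≤ P₂ and the closed interval [P₁, P₂] is contained in the product set E(α,s)·F(α,s) = { e·f : e ∈ E(α,s), f ∈ F(α,s) }. -/

import Mathlib

open Filter Finset

/-- Distance from `x` to the nearest integer. -/
noncomputable def nint (x : ℝ) : ℝ := |x - (round x : ℝ)|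

/-- One-sided inhomogeneous approximation constant
`M₊(α,β) = liminf_{q→∞} q‖qα−β‖` over positive integers `q`. -/
noncomputable def Mplus (α β : ℝ) : ℝ :=
  Filter.liminf (fun q : ℕ => (q : ℝ) * nint (q * α - β)) Filter.atTop

/-- Complete quotients of the negative continued fraction: `ncq α i = α_{i+1}`,
so `ncq α 0 = α₁ = α` and `α_{i+1} = a_i - 1/α_i` with `a_i = ⌈1/α_i⌉`. -/
noncomputable def ncq (α : ℝ) : ℕ → ℝ
  | 0 => α
  | i + 1 => (⌈(ncq α i)⁻¹⌉ : ℝ) - (ncq α i)⁻¹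

/-- Partial quotients of the negative continued fraction: `npq α i = a_i = ⌈1/α_i⌉` for `i ≥ 1`. -/
noncomputable def npq (α : ℝ) (i : ℕ) : ℤ := ⌈(ncq α (i - 1))⁻¹⌉

/-- Convergent denominators: `q₀ = 1`, `q₁ = a₁`, `q_{i+2} = a_{i+2} q_{i+1} − q_i`. -/
noncomputable def nq (α : ℝ) : ℕ → ℤ
  | 0 => 1
  | 1 => npq α 1
  | i + 2 => npq α (i + 2) * nq α (i + 1) - nq α i

/-- Convergent numerators: `p₀ = 0`, `p₁ = 1`, `p_{i+2} = a_{i+2} p_{i+1} − p_i`. -/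
noncomputable def np (α : ℝ) : ℕ → ℤ
  | 0 => 0
  | 1 => 1
  | i + 2 => npq α (i + 2) * np α (i + 1) - np α i

/-- `Dk α k = α₁α₂⋯α_k` (with `Dk α 0 = 1`). -/
noncomputable def Dk (α : ℝ) (k : ℕ) : ℝ := ∏ j ∈ Finset.range k, ncq α j

/-- Davenport remainders: `drem α β i = β_{i+1}`, so `drem α β 0 = β₁ = β` and
`β_{i+1} = β_i/α_i − ⌊β_i/α_i⌋`. -/
noncomputable def drem (α β : ℝ) : ℕ → ℝ
  | 0 => β
  | i + 1 => Int.fract (drem α β i / ncq α i)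

/-- Davenport coefficients: `db α β i = b_i = ⌊β_i/α_i⌋` for `i ≥ 1`. -/
noncomputable def db (α β : ℝ) (i : ℕ) : ℤ := ⌊drem α β (i - 1) / ncq α (i - 1)⌋

/-- `Qn α β n = Σ_{k=1}^n b_k q_{k−1}`. -/
noncomputable def Qn (α β : ℝ) (n : ℕ) : ℤ :=
  ∑ k ∈ Finset.Icc 1 n, db α β k * nq α (k - 1)

/-- `Q′_n`. -/
noncomputable def Qn' (α β : ℝ) (n : ℕ) : ℤ :=
  if Qn α β n < nq α n - nq α (n - 1) then Qn α β n + nq α (n - 1)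
  else Qn α β n + nq α (n - 1) - nq α n

/-- `λ_n(β) = Q_n D_n β_{n+1}`. -/
noncomputable def lam (α β : ℝ) (n : ℕ) : ℝ :=
  (Qn α β n : ℝ) * Dk α n * drem α β n

/-- `ρ_n(β)`. -/
noncomputable def rho (α β : ℝ) (n : ℕ) : ℝ :=
  if Qn α β n < nq α n - nq α (n - 1)
  then (Qn' α β n : ℝ) * Dk α n * (1 - drem α β n)
  else (Qn' α β n : ℝ) * Dk α n * (1 - ncq α n - drem α β n)

/-- Reversed quotients: `ᾱ₀ = 0`, `ᾱ_i = 1/(a_i − ᾱ_{i−1})`. -/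
noncomputable def rq (α : ℝ) : ℕ → ℝ
  | 0 => 0
  | i + 1 => ((npq α (i + 1) : ℝ) - rq α i)⁻¹

/-- `E(α,s)`: the set of `β ∈ [0,1)` whose Davenport coefficients contain no block of
`s+1` consecutive zeros and no block
`(b_i, …, b_{i+s}) = (a_i−2, a_{i+1}−2, …, a_{i+s−1}−2, a_{i+s}−1)`. -/
def Eset (α : ℝ) (s : ℕ) : Set ℝ :=
  {β : ℝ | 0 ≤ β ∧ β < 1 ∧ ∀ i : ℕ, 1 ≤ i →
    (∃ l : ℕ, i ≤ l ∧ l ≤ i + s ∧ db α β l ≠ 0) ∧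
    ¬ ((∀ l : ℕ, i ≤ l → l < i + s → db α β l = npq α l - 2) ∧
        db α β (i + s) = npq α (i + s) - 1)}

/-- `F(α,s)`: the set of `β ∈ [0,1)` whose Davenport coefficients contain no block of
`s+1` consecutive zeros and no block `(b_i, …, b_{i+s}) = (a_i−1, a_{i+1}−2, …, a_{i+s}−2)`. -/
def Fset (α : ℝ) (s : ℕ) : Set ℝ :=
  {β : ℝ | 0 ≤ β ∧ β < 1 ∧ ∀ i : ℕ, 1 ≤ i →
    (∃ l : ℕ, i ≤ l ∧ l ≤ i + s ∧ db α β l ≠ 0) ∧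
    ¬ (db α β i = npq α i - 1 ∧
        ∀ l : ℕ, i < l → l ≤ i + s → db α β l = npq α l - 2)}

/-- A binary subdivision scheme for intervals `[lft t, lft t + len t]`: every valid cell is cut
into a left and a right cell, each of relative length at least `c`. -/
structure SplitTree (T : Type*) where
  Valid : T → Prop
  lft : T → ℝ
  len : T → ℝ
  L : T → T
  R : T → T
  c : ℝ
  c_pos : 0 < c
  valid_L : ∀ t, Valid t → Valid (L t)
  valid_R : ∀ t, Valid t → Valid (R t)
  len_pos : ∀ t, Valid t → 0 < len t
  lft_L : ∀ t, Valid t → lft (L t) = lft t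
  lft_R : ∀ t, Valid t → lft (R t) = lft t + len (L t)
  len_add : ∀ t, Valid t → len (L t) + len (R t) = len t
  le_len_L : ∀ t, Valid t → c * len t ≤ len (L t)
  le_len_R : ∀ t, Valid t → c * len t ≤ len (R t)

/-- A cell together with the lengths `p`, `q` of its largest ancestors having the same left,
respectively right, endpoint. -/
structure MarkedCell (T : Type*) where
  cell : T
  p : ℝ
  q : ℝ

namespace SplitTree

variable {T : Type*} (S : SplitTree T) (ε : ℝ)

/-- The marked left half. -/
def mL (x : MarkedCell T) : MarkedCell T := ⟨S.L x.cell, x.p, S.len (S.L x.cell)⟩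

/-- The marked right half. -/
def mR (x : MarkedCell T) : MarkedCell T := ⟨S.R x.cell, S.len (S.R x.cell), x.q⟩

/-- A marked cell is admissible if it lies in `[0,1]` and is not too short compared with the
ancestors sharing an endpoint with it. -/
structure Adm (x : MarkedCell T) : Prop where
  valid : S.Valid x.cell
  lft_nonneg : 0 ≤ S.lft x.cell
  right_le : S.lft x.cell + S.len x.cell ≤ 1
  len_le_p : S.len x.cell ≤ x.p
  len_le_q : S.len x.cell ≤ x.q
  fresh : x.p = S.len x.cell ∨ x.q = S.len x.cell
  p_le : ε * x.p ≤ S.len x.cell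
  q_le : ε * x.q ≤ S.len x.cell

variable {S ε}

theorem Adm.left {x : MarkedCell T} (h : S.Adm ε x) (hε1 : ε ≤ 1)
    (hp : ε * x.p ≤ S.len (S.L x.cell)) : S.Adm ε (S.mL x) := by
  obtain ⟨hv, h0, h1, h2, h3, h4, h5, h6⟩ := h
  have a1 := S.len_pos _ (S.valid_L _ hv)
  have a2 := S.len_pos _ (S.valid_R _ hv)
  have a3 := S.len_add _ hv
  have a4 := S.lft_L _ hv
  refine ⟨S.valid_L _ hv, ?_, ?_, ?_, le_rfl, Or.inr rfl, hp, ?_⟩ <;> simp only [mL]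
  · linarith
  · linarith
  · linarith
  · nlinarith

theorem Adm.right {x : MarkedCell T} (h : S.Adm ε x) (hε1 : ε ≤ 1)
    (hq : ε * x.q ≤ S.len (S.R x.cell)) : S.Adm ε (S.mR x) := by
  obtain ⟨hv, h0, h1, h2, h3, h4, h5, h6⟩ := h
  have a1 := S.len_pos _ (S.valid_L _ hv)
  have a2 := S.len_pos _ (S.valid_R _ hv)
  have a3 := S.len_add _ hv
  have a4 := S.lft_R _ hv
  refine ⟨S.valid_R _ hv, ?_, ?_, le_rfl, ?_, Or.inl rfl, ?_, hq⟩ <;> simp only [mR]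
  · linarith
  · linarith
  · linarith
  · nlinarith

/-- If the left half is not admissible, the right half is. -/
theorem Adm.right_of_not_left {x : MarkedCell T} (h : S.Adm ε x) (hε1 : ε ≤ 1) (hεc : ε ≤ S.c)
    (hL : ¬ S.Adm ε (S.mL x)) : S.Adm ε (S.mR x) := by
  have hlt : S.len (S.L x.cell) < ε * x.p := by
    by_contra hcon
    exact hL (h.left hε1 (not_lt.mp hcon))
  have a1 := S.le_len_L _ h.valid
  have a2 := S.le_len_R _ h.valid
  have a3 := S.len_pos _ h.valid
  refine h.right hε1 ?_
  rcases h.fresh with hp | hq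
  · rw [hp] at hlt
    nlinarith
  · rw [hq]
    nlinarith

/-- If the right half is not admissible, the left half is. -/
theorem Adm.left_of_not_right {x : MarkedCell T} (h : S.Adm ε x) (hε1 : ε ≤ 1) (hεc : ε ≤ S.c)
    (hR : ¬ S.Adm ε (S.mR x)) : S.Adm ε (S.mL x) := by
  by_contra hL
  exact hR (h.right_of_not_left hε1 hεc hL)

variable (S ε)

open Classical in
/-- The leftmost admissible half. -/
noncomputable def nextL (x : MarkedCell T) : MarkedCell T :=
  if S.Adm ε (S.mL x) then S.mL x else S.mR x

open Classical in
/-- The rightmost admissible half. -/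
noncomputable def nextR (x : MarkedCell T) : MarkedCell T :=
  if S.Adm ε (S.mR x) then S.mR x else S.mL x

/-- The least point that survives below a marked cell. -/
noncomputable def lo (x : MarkedCell T) : ℝ := ⨆ k, S.lft ((S.nextL ε)^[k] x).cell

/-- The greatest point that survives below a marked cell. -/
noncomputable def hi (x : MarkedCell T) : ℝ :=
  ⨅ k, (S.lft ((S.nextR ε)^[k] x).cell + S.len ((S.nextR ε)^[k] x).cell)

variable {S ε}

theorem Adm.nextL {x : MarkedCell T} (h : S.Adm ε x) (hε1 : ε ≤ 1) (hεc : ε ≤ S.c) :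
    S.Adm ε (S.nextL ε x) := by
  unfold SplitTree.nextL
  split_ifs with hL
  · exact hL
  · exact h.right_of_not_left hε1 hεc hL

theorem Adm.nextR {x : MarkedCell T} (h : S.Adm ε x) (hε1 : ε ≤ 1) (hεc : ε ≤ S.c) :
    S.Adm ε (S.nextR ε x) := by
  unfold SplitTree.nextR
  split_ifs with hR
  · exact hR
  · exact h.left_of_not_right hε1 hεc hR

/-- `y` is one of the halves of `x`. -/
def IsHalf (S : SplitTree T) (x y : MarkedCell T) : Prop := y = S.mL x ∨ y = S.mR x

theorem isHalf_nextL (x : MarkedCell T) : S.IsHalf x (S.nextL ε x) := by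
  unfold SplitTree.nextL IsHalf
  split_ifs <;> simp

theorem isHalf_nextR (x : MarkedCell T) : S.IsHalf x (S.nextR ε x) := by
  unfold SplitTree.nextR IsHalf
  split_ifs <;> simp

theorem IsHalf.bounds {x y : MarkedCell T} (hy : S.IsHalf x y) (hv : S.Valid x.cell) :
    S.lft x.cell ≤ S.lft y.cell ∧
    S.lft y.cell + S.len y.cell ≤ S.lft x.cell + S.len x.cell ∧
    S.len y.cell ≤ (1 - S.c) * S.len x.cell ∧ S.c * S.len x.cell ≤ S.len y.cell := by
  have a1 := S.len_pos _ (S.valid_L _ hv)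
  have a2 := S.len_pos _ (S.valid_R _ hv)
  have a3 := S.len_add _ hv
  have a4 := S.lft_R _ hv
  have a5 := S.lft_L _ hv
  have a6 := S.le_len_L _ hv
  have a7 := S.le_len_R _ hv
  rcases hy with rfl | rfl <;> simp only [mL, mR] <;>
    exact ⟨by linarith, by linarith, by linarith, by linarith⟩

theorem c_le_half (S : SplitTree T) {t : T} (hv : S.Valid t) : S.c ≤ 1 / 2 := by
  have a1 := S.len_pos _ hv
  have a3 := S.len_add _ hv
  have a6 := S.le_len_L _ hv
  have a7 := S.le_len_R _ hv
  nlinarith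

theorem Adm.iterate {g : MarkedCell T → MarkedCell T}
    (hadm : ∀ x, S.Adm ε x → S.Adm ε (g x)) (hg : ∀ x, S.IsHalf x (g x))
    {x : MarkedCell T} (h : S.Adm ε x) (k : ℕ) :
    S.Adm ε (g^[k] x) ∧ S.lft x.cell ≤ S.lft (g^[k] x).cell ∧
    S.lft (g^[k] x).cell + S.len (g^[k] x).cell ≤ S.lft x.cell + S.len x.cell := by
  induction k with
  | zero => exact ⟨h, le_rfl, le_rfl⟩
  | succ k ih =>
    rw [Function.iterate_succ_apply']
    obtain ⟨i1, i2, i3⟩ := ih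
    have hb := (hg (g^[k] x)).bounds i1.valid
    exact ⟨hadm _ i1, i2.trans hb.1, hb.2.1.trans i3⟩

theorem Adm.lft_le_lo_le {x : MarkedCell T} (h : S.Adm ε x) (hε1 : ε ≤ 1) (hεc : ε ≤ S.c) :
    S.lft x.cell ≤ S.lo ε x ∧ S.lo ε x ≤ S.lft x.cell + S.len x.cell ∧
    S.lo ε x = S.lo ε (S.nextL ε x) := by
  have key := fun (y : MarkedCell T) (hy : S.Adm ε y) (k : ℕ) =>
    Adm.iterate (fun z hz => Adm.nextL hz hε1 hεc) (isHalf_nextL (ε := ε)) hy k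
  have upper : ∀ (y : MarkedCell T), S.Adm ε y → ∀ k,
      S.lft ((S.nextL ε)^[k] y).cell ≤ S.lft y.cell + S.len y.cell := fun y hy k => by
    have := key y hy k
    have := S.len_pos _ (key y hy k).1.valid
    linarith
  have bdd : ∀ (y : MarkedCell T), S.Adm ε y →
      BddAbove (Set.range fun k => S.lft ((S.nextL ε)^[k] y).cell) := fun y hy =>
    ⟨_, by rintro _ ⟨k, rfl⟩; exact upper y hy k⟩
  have hn := h.nextL hε1 hεc
  refine ⟨le_ciSup (bdd x h) 0, ciSup_le (upper x h), le_antisymm ?_ ?_⟩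
  · refine ciSup_le fun k => ?_
    have h1 := ((isHalf_nextL (ε := ε) ((S.nextL ε)^[k] x)).bounds (key x h k).1.valid).1
    rw [← Function.iterate_succ_apply' (S.nextL ε), Function.iterate_succ_apply] at h1
    exact h1.trans (le_ciSup (bdd _ hn) k)
  · refine ciSup_le fun k => ?_
    rw [← Function.iterate_succ_apply]
    exact le_ciSup (bdd x h) (k + 1)

theorem Adm.le_hi_le_right {x : MarkedCell T} (h : S.Adm ε x) (hε1 : ε ≤ 1) (hεc : ε ≤ S.c) :
    S.lft x.cell ≤ S.hi ε x ∧ S.hi ε x ≤ S.lft x.cell + S.len x.cell ∧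
    S.hi ε x = S.hi ε (S.nextR ε x) := by
  have key := fun (y : MarkedCell T) (hy : S.Adm ε y) (k : ℕ) =>
    Adm.iterate (fun z hz => Adm.nextR hz hε1 hεc) (isHalf_nextR (ε := ε)) hy k
  have lower : ∀ (y : MarkedCell T), S.Adm ε y → ∀ k,
      S.lft y.cell ≤ S.lft ((S.nextR ε)^[k] y).cell + S.len ((S.nextR ε)^[k] y).cell :=
    fun y hy k => by
      have := key y hy k
      have := S.len_pos _ (key y hy k).1.valid
      linarith
  have bdd : ∀ (y : MarkedCell T), S.Adm ε y → BddBelow (Set.range fun k =>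
      S.lft ((S.nextR ε)^[k] y).cell + S.len ((S.nextR ε)^[k] y).cell) := fun y hy =>
    ⟨_, by rintro _ ⟨k, rfl⟩; exact lower y hy k⟩
  have hn := h.nextR hε1 hεc
  refine ⟨le_ciInf (lower x h), ciInf_le (bdd x h) 0, le_antisymm ?_ ?_⟩
  · refine le_ciInf fun k => ?_
    rw [← Function.iterate_succ_apply]
    exact ciInf_le (bdd x h) (k + 1)
  · refine le_ciInf fun k => ?_
    have h1 := ((isHalf_nextR (ε := ε) ((S.nextR ε)^[k] x)).bounds (key x h k).1.valid).2.1
    rw [← Function.iterate_succ_apply' (S.nextR ε), Function.iterate_succ_apply] at h1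
    exact (ciInf_le (bdd _ hn) k).trans h1

theorem exists_pow_mul_le {r a b : ℝ} (h1 : r < 1) (ha : 0 < a) (hb : 0 < b) :
    ∃ m : ℕ, r ^ m * a ≤ b := by
  obtain ⟨m, hm⟩ := exists_pow_lt_of_lt_one (div_pos hb ha) h1
  exact ⟨m, ((lt_div_iff₀ ha).mp hm).le⟩

/-- The surviving points come close to the left endpoint. -/
theorem Adm.lo_le {x : MarkedCell T} (h : S.Adm ε x) (hε0 : 0 < ε) (hε1 : ε ≤ 1)
    (hεc : ε ≤ S.c) : S.lo ε x ≤ S.lft x.cell + ε * x.p / S.c := by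
  have hc := S.c_pos
  have main : ∀ m : ℕ, ∀ y : MarkedCell T, S.Adm ε y →
      S.lo ε y ≤ S.lft y.cell + max (ε * y.p / S.c) ((1 - S.c) ^ m * S.len y.cell) := by
    intro m
    induction m with
    | zero =>
      intro y hy
      have := (hy.lft_le_lo_le hε1 hεc).2.1
      have := le_max_right (ε * y.p / S.c) ((1 - S.c) ^ 0 * S.len y.cell)
      simp only [pow_zero, one_mul] at this ⊢
      linarith
    | succ m ih =>
      intro y hy
      have hlo := hy.lft_le_lo_le hε1 hεc
      by_cases hL : S.Adm ε (S.mL y)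
      · rw [hlo.2.2, SplitTree.nextL, if_pos hL]
        have h1 := ih _ hL
        have hb := (show S.IsHalf y (S.mL y) from Or.inl rfl).bounds hy.valid
        have hch := S.c_le_half hy.valid
        have hpow : (1 - S.c) ^ m * S.len (S.mL y).cell ≤ (1 - S.c) ^ (m + 1) * S.len y.cell := by
          rw [pow_succ, mul_assoc]
          exact mul_le_mul_of_nonneg_left hb.2.2.1 (pow_nonneg (by linarith) _)
        have h2 := max_le_max_left (ε * y.p / S.c) hpow
        have h3 : S.lft (S.mL y).cell = S.lft y.cell := S.lft_L _ hy.valid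
        have h4 : (S.mL y).p = y.p := rfl
        rw [h3, h4] at h1
        linarith
      · have hlt : S.len (S.L y.cell) < ε * y.p := by
          by_contra hcon
          exact hL (hy.left hε1 (not_lt.mp hcon))
        have h1 : S.len y.cell ≤ ε * y.p / S.c := by
          rw [le_div_iff₀ hc]
          have := S.le_len_L _ hy.valid
          linarith
        have := le_max_left (ε * y.p / S.c) ((1 - S.c) ^ (m + 1) * S.len y.cell)
        linarith
  have hl := S.len_pos _ h.valid
  have hch := S.c_le_half h.valid
  have hp : 0 < ε * x.p / S.c := div_pos (mul_pos hε0 (hl.trans_le h.len_le_p)) hc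
  obtain ⟨m, hm⟩ := exists_pow_mul_le (by linarith : 1 - S.c < 1) hl hp
  simpa [max_eq_left hm] using main m x h

/-- The surviving points come close to the right endpoint. -/
theorem Adm.le_hi {x : MarkedCell T} (h : S.Adm ε x) (hε0 : 0 < ε) (hε1 : ε ≤ 1)
    (hεc : ε ≤ S.c) : S.lft x.cell + S.len x.cell - ε * x.q / S.c ≤ S.hi ε x := by
  have hc := S.c_pos
  have main : ∀ m : ℕ, ∀ y : MarkedCell T, S.Adm ε y →
      S.lft y.cell + S.len y.cell - max (ε * y.q / S.c) ((1 - S.c) ^ m * S.len y.cell)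
        ≤ S.hi ε y := by
    intro m
    induction m with
    | zero =>
      intro y hy
      have := (hy.le_hi_le_right hε1 hεc).1
      have := le_max_right (ε * y.q / S.c) ((1 - S.c) ^ 0 * S.len y.cell)
      simp only [pow_zero, one_mul] at this ⊢
      linarith
    | succ m ih =>
      intro y hy
      have hhi := hy.le_hi_le_right hε1 hεc
      by_cases hR : S.Adm ε (S.mR y)
      · rw [hhi.2.2, SplitTree.nextR, if_pos hR]
        have h1 := ih _ hR
        have hb := (show S.IsHalf y (S.mR y) from Or.inr rfl).bounds hy.valid
        have hch := S.c_le_half hy.valid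
        have hpow : (1 - S.c) ^ m * S.len (S.mR y).cell ≤ (1 - S.c) ^ (m + 1) * S.len y.cell := by
          rw [pow_succ, mul_assoc]
          exact mul_le_mul_of_nonneg_left hb.2.2.1 (pow_nonneg (by linarith) _)
        have h2 := max_le_max_left (ε * y.q / S.c) hpow
        have h3 : S.lft (S.mR y).cell + S.len (S.mR y).cell = S.lft y.cell + S.len y.cell := by
          have := S.lft_R _ hy.valid
          have := S.len_add _ hy.valid
          simp only [mR]
          linarith
        have h4 : (S.mR y).q = y.q := rfl
        rw [h3, h4] at h1
        linarith
      · have hlt : S.len (S.R y.cell) < ε * y.q := by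
          by_contra hcon
          exact hR (hy.right hε1 (not_lt.mp hcon))
        have h1 : S.len y.cell ≤ ε * y.q / S.c := by
          rw [le_div_iff₀ hc]
          have := S.le_len_R _ hy.valid
          linarith
        have := le_max_left (ε * y.q / S.c) ((1 - S.c) ^ (m + 1) * S.len y.cell)
        linarith
  have hl := S.len_pos _ h.valid
  have hch := S.c_le_half h.valid
  have hq : 0 < ε * x.q / S.c := div_pos (mul_pos hε0 (hl.trans_le h.len_le_q)) hc
  obtain ⟨m, hm⟩ := exists_pow_mul_le (by linarith : 1 - S.c < 1) hl hq
  simpa [max_eq_left hm] using main m x h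

/-- The surviving points of a cell span a fixed proportion of it. -/
theorem Adm.le_hi_sub_lo {x : MarkedCell T} (h : S.Adm ε x) (hε0 : 0 < ε) (hε1 : ε ≤ 1)
    (hεc : ε ≤ S.c ^ 2 / 4) : S.c / 2 * S.len x.cell ≤ S.hi ε x - S.lo ε x := by
  have hc := S.c_pos
  have hch := S.c_le_half h.valid
  have hl := S.len_pos _ h.valid
  have hεc' : ε ≤ S.c := by nlinarith
  have hlo := h.lft_le_lo_le hε1 hεc'
  have hhi := h.le_hi_le_right hε1 hεc'
  have a3 := S.len_add _ h.valid
  have a4 := S.lft_R _ h.valid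
  have a5 := S.lft_L _ h.valid
  have a6 := S.le_len_L _ h.valid
  have a7 := S.le_len_R _ h.valid
  have b1 := S.len_pos _ (S.valid_L _ h.valid)
  have b2 := S.len_pos _ (S.valid_R _ h.valid)
  have small : ∀ y, 0 ≤ y → y ≤ S.len x.cell → ε * y / S.c ≤ S.c / 4 * S.len x.cell := by
    intro y hy hyl
    rw [div_le_iff₀ hc]
    nlinarith [mul_le_mul_of_nonneg_right hεc hy, mul_le_mul_of_nonneg_left hyl (sq_nonneg S.c)]
  rcases h.fresh with hp | hq
  · have h1 := h.lo_le hε0 hε1 hεc'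
    rw [hp] at h1
    have h2 := small _ hl.le le_rfl
    have h3 : S.lft x.cell + S.c * S.len x.cell - S.c / 4 * S.len x.cell ≤ S.hi ε x := by
      rw [hhi.2.2, SplitTree.nextR]
      split_ifs with hR
      · have := (hR.le_hi_le_right hε1 hεc').1
        simp only [mR] at this ⊢
        nlinarith
      · have hL := h.left_of_not_right hε1 hεc' hR
        have := hL.le_hi hε0 hε1 hεc'
        have := small _ b1.le (by linarith)
        simp only [mL] at *
        linarith
    linarith
  · have h1 := h.le_hi hε0 hε1 hεc'
    rw [hq] at h1
    have h2 := small _ hl.le le_rfl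
    have h3 : S.lo ε x ≤ S.lft x.cell + S.len x.cell - S.c * S.len x.cell
        + S.c / 4 * S.len x.cell := by
      rw [hlo.2.2, SplitTree.nextL]
      split_ifs with hL
      · have := (hL.lft_le_lo_le hε1 hεc').2.1
        simp only [mL] at this ⊢
        nlinarith
      · have hR := h.right_of_not_left hε1 hεc' hL
        have := hR.lo_le hε0 hε1 hεc'
        have := small _ b2.le (by linarith)
        simp only [mR] at *
        linarith
    linarith

theorem Adm.lo_nonneg {x : MarkedCell T} (h : S.Adm ε x) (hε1 : ε ≤ 1) (hεc : ε ≤ S.c) :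
    0 ≤ S.lo ε x := h.lft_nonneg.trans (h.lft_le_lo_le hε1 hεc).1

theorem Adm.hi_pos {x : MarkedCell T} (h : S.Adm ε x) (hε0 : 0 < ε) (hε1 : ε ≤ 1)
    (hεc : ε ≤ S.c ^ 2 / 4) (hεc' : ε ≤ S.c) : 0 < S.hi ε x := by
  have h1 := h.le_hi_sub_lo hε0 hε1 hεc
  have h2 := h.lo_nonneg hε1 hεc'
  have h3 := mul_pos (half_pos S.c_pos) (S.len_pos _ h.valid)
  linarith

theorem Adm.hull_half {x y : MarkedCell T} (h : S.Adm ε x) (hy : S.Adm ε y) (hxy : S.IsHalf x y)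
    (hε1 : ε ≤ 1) (hεc : ε ≤ S.c) : S.lo ε x ≤ S.lo ε y ∧ S.hi ε y ≤ S.hi ε x := by
  have hlo := (h.lft_le_lo_le hε1 hεc).2.2
  have hhi := (h.le_hi_le_right hε1 hεc).2.2
  have a4 := S.lft_R _ h.valid
  have a5 := S.lft_L _ h.valid
  rcases hxy with rfl | rfl
  · constructor
    · rw [hlo, SplitTree.nextL, if_pos hy]
    · rw [hhi, SplitTree.nextR]
      split_ifs with hR
      · have b1 := (hR.le_hi_le_right hε1 hεc).1
        have b2 := (hy.le_hi_le_right hε1 hεc).2.1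
        simp only [mL, mR] at *
        linarith
      · exact le_rfl
  · constructor
    · rw [hlo, SplitTree.nextL]
      split_ifs with hL
      · have b1 := (hL.lft_le_lo_le hε1 hεc).2.1
        have b2 := (hy.lft_le_lo_le hε1 hεc).1
        simp only [mL, mR] at *
        linarith
      · exact le_rfl
    · rw [hhi, SplitTree.nextR, if_pos hy]

variable (S ε) in
/-- The relative width of the set of surviving points below a marked cell. -/
noncomputable def spread (x : MarkedCell T) : ℝ := (S.hi ε x - S.lo ε x) / S.hi ε x

theorem Adm.spread_half {x y : MarkedCell T} (h : S.Adm ε x) (hy : S.Adm ε y)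
    (hxy : S.IsHalf x y) (hε0 : 0 < ε) (hε1 : ε ≤ 1) (hεc : ε ≤ S.c ^ 2 / 4) (hεc' : ε ≤ S.c) :
    S.spread ε y ≤ S.spread ε x ∧ S.c ^ 2 / 2 * S.spread ε x ≤ S.spread ε y := by
  have hx0 := h.hi_pos hε0 hε1 hεc hεc'
  have hy0 := hy.hi_pos hε0 hε1 hεc hεc'
  have hxl := h.lo_nonneg hε1 hεc'
  obtain ⟨h1, h2⟩ := h.hull_half hy hxy hε1 hεc'
  have hb := hxy.bounds h.valid
  have hw := hy.le_hi_sub_lo hε0 hε1 hεc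
  have b1 := (h.lft_le_lo_le hε1 hεc').1
  have b2 := (h.le_hi_le_right hε1 hεc').2.1
  have hc := S.c_pos
  have hwy : 0 ≤ S.hi ε y - S.lo ε y :=
    (mul_nonneg (half_pos hc).le (S.len_pos _ hy.valid).le).trans hw
  unfold spread
  constructor
  · rw [div_le_div_iff₀ hy0 hx0]
    nlinarith
  · calc S.c ^ 2 / 2 * ((S.hi ε x - S.lo ε x) / S.hi ε x)
        = S.c ^ 2 / 2 * (S.hi ε x - S.lo ε x) / S.hi ε x := by ring
      _ ≤ (S.hi ε y - S.lo ε y) / S.hi ε x := by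
          gcongr
          have : S.c ^ 2 / 2 * (S.hi ε x - S.lo ε x) ≤ S.c ^ 2 / 2 * S.len x.cell := by
            gcongr
            linarith
          have : S.c / 2 * (S.c * S.len x.cell) ≤ S.c / 2 * S.len y.cell := by
            gcongr
            exact hb.2.2.2
          nlinarith
      _ ≤ (S.hi ε y - S.lo ε y) / S.hi ε y := by gcongr

/-- If the products of two hulls cover `z`, then `z` is still covered after a suitable half of
the cell with larger spread is chosen. -/
theorem Adm.exists_half {x y : MarkedCell T} {z : ℝ} (hx : S.Adm ε x) (hy : S.Adm ε y)
    (hε0 : 0 < ε) (hε1 : ε ≤ 1) (hεc : ε ≤ S.c ^ 2 / 4) (hεc' : ε ≤ S.c)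
    (hεc'' : ε ≤ S.c ^ 5 / 4) (hs : S.c ^ 2 / 2 * S.spread ε x ≤ S.spread ε y)
    (hz1 : S.lo ε x * S.lo ε y ≤ z) (hz2 : z ≤ S.hi ε x * S.hi ε y) :
    ∃ x', S.IsHalf x x' ∧ S.Adm ε x' ∧
      S.lo ε x' * S.lo ε y ≤ z ∧ z ≤ S.hi ε x' * S.hi ε y := by
  have hlo := hx.lft_le_lo_le hε1 hεc'
  have hhi := hx.le_hi_le_right hε1 hεc'
  have hc := S.c_pos
  by_cases hL : S.Adm ε (S.mL x)
  · have hloL : S.lo ε x = S.lo ε (S.mL x) := by rw [hlo.2.2, SplitTree.nextL, if_pos hL]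
    by_cases hR : S.Adm ε (S.mR x)
    · have hhiR : S.hi ε x = S.hi ε (S.mR x) := by rw [hhi.2.2, SplitTree.nextR, if_pos hR]
      by_cases hcase : z ≤ S.hi ε (S.mL x) * S.hi ε y
      · exact ⟨_, Or.inl rfl, hL, by rwa [← hloL], hcase⟩
      · refine ⟨_, Or.inr rfl, hR, ?_, by rwa [← hhiR]⟩
        refine le_trans ?_ (not_le.mp hcase).le
        have hx0 := hx.hi_pos hε0 hε1 hεc hεc'
        have hy0 := hy.hi_pos hε0 hε1 hεc hεc'
        have hl := S.len_pos _ hx.valid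
        have a3 := S.len_add _ hx.valid
        have a4 := S.lft_R _ hx.valid
        have a5 := S.lft_L _ hx.valid
        have a6 := S.le_len_L _ hx.valid
        have hw := hx.le_hi_sub_lo hε0 hε1 hεc
        have g1 := hL.le_hi hε0 hε1 hεc'
        have g2 := hR.lo_le hε0 hε1 hεc'
        have g3 := (hR.lft_le_lo_le hε1 hεc').1
        have hch := S.c_le_half hx.valid
        have h0 := hx.lft_nonneg
        simp only [mL, mR] at g1 g2 g3
        have gap : S.lo ε (S.mR x) - S.hi ε (S.mL x) ≤ S.c ^ 4 / 4 * S.len x.cell := by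
          have e1 : S.lo ε (S.mR x) - S.hi ε (S.mL x) ≤ ε * S.len x.cell / S.c := by
            have : ε * S.len x.cell / S.c =
                ε * S.len (S.L x.cell) / S.c + ε * S.len (S.R x.cell) / S.c := by
              rw [← a3]; ring
            simp only [mL, mR]
            linarith
          refine e1.trans ?_
          rw [div_le_iff₀ hc]
          nlinarith [mul_le_mul_of_nonneg_right hεc'' hl.le]
        have low : S.c * S.hi ε x ≤ S.lo ε (S.mR x) := by
          have : S.c * S.hi ε x ≤ S.c * (S.lft x.cell + S.len x.cell) := by
            gcongr
            exact hhi.2.1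
          have : S.c * S.lft x.cell ≤ S.lft x.cell := by nlinarith
          simp only [mR]
          linarith
        have hs' : S.c ^ 2 / 2 * (S.hi ε x - S.lo ε x) * S.hi ε y
            ≤ (S.hi ε y - S.lo ε y) * S.hi ε x := by
          unfold spread at hs
          rw [← mul_div_assoc, div_le_div_iff₀ hx0 hy0] at hs
          exact hs
        have key : S.c ^ 3 / 4 * S.len x.cell * S.hi ε y
            ≤ (S.hi ε y - S.lo ε y) * S.hi ε x := by
          refine le_trans (mul_le_mul_of_nonneg_right ?_ hy0.le) hs'
          nlinarith [mul_le_mul_of_nonneg_left hw (by positivity : 0 ≤ S.c ^ 2 / 2)]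
        have wy : 0 ≤ S.hi ε y - S.lo ε y := by
          have := hy.le_hi_sub_lo hε0 hε1 hεc
          have := mul_pos (half_pos hc) (S.len_pos _ hy.valid)
          linarith
        have f1 : (S.lo ε (S.mR x) - S.hi ε (S.mL x)) * S.hi ε y
            ≤ S.c ^ 4 / 4 * S.len x.cell * S.hi ε y := by gcongr
        have f2 : (S.hi ε y - S.lo ε y) * (S.c * S.hi ε x)
            ≤ (S.hi ε y - S.lo ε y) * S.lo ε (S.mR x) := by gcongr
        have f3 : S.c * (S.c ^ 3 / 4 * S.len x.cell * S.hi ε y)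
            ≤ S.c * ((S.hi ε y - S.lo ε y) * S.hi ε x) := by gcongr
        have f4 : S.c * (S.c ^ 3 / 4 * S.len x.cell * S.hi ε y) =
          S.c ^ 4 / 4 * S.len x.cell * S.hi ε y := by ring
        have f5 : S.c * ((S.hi ε y - S.lo ε y) * S.hi ε x) =
          (S.hi ε y - S.lo ε y) * (S.c * S.hi ε x) := by ring
        have f6 : (S.lo ε (S.mR x) - S.hi ε (S.mL x)) * S.hi ε y ≤
          (S.hi ε y - S.lo ε y) * S.lo ε (S.mR x) := by linarith
        linarith
    · exact ⟨_, Or.inl rfl, hL, by rwa [← hloL], by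
        rwa [show S.hi ε (S.mL x) = S.hi ε x by rw [hhi.2.2, SplitTree.nextR, if_neg hR]]⟩
  · have hR := hx.right_of_not_left hε1 hεc' hL
    exact ⟨_, Or.inr rfl, hR, by
      rwa [show S.lo ε (S.mR x) = S.lo ε x by rw [hlo.2.2, SplitTree.nextL, if_neg hL]], by
      rwa [show S.hi ε (S.mR x) = S.hi ε x by rw [hhi.2.2, SplitTree.nextR, if_pos hR]]⟩

/-- Two marked cells of comparable spread whose hulls have `z` in their product. -/
structure Linked (S : SplitTree T) (ε z : ℝ) (P : MarkedCell T × MarkedCell T) : Prop where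
  adm_fst : S.Adm ε P.1
  adm_snd : S.Adm ε P.2
  lo_le : S.lo ε P.1 * S.lo ε P.2 ≤ z
  le_hi : z ≤ S.hi ε P.1 * S.hi ε P.2
  spread_fst : S.c ^ 2 / 2 * S.spread ε P.1 ≤ S.spread ε P.2
  spread_snd : S.c ^ 2 / 2 * S.spread ε P.2 ≤ S.spread ε P.1

theorem Linked.swap {z : ℝ} {P : MarkedCell T × MarkedCell T} (h : S.Linked ε z P) :
    S.Linked ε z P.swap :=
  ⟨h.adm_snd, h.adm_fst, by simpa [mul_comm] using h.lo_le, by simpa [mul_comm] using h.le_hi,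
    h.spread_snd, h.spread_fst⟩

theorem Linked.step_fst {z : ℝ} {P : MarkedCell T × MarkedCell T} (h : S.Linked ε z P)
    (hε0 : 0 < ε) (hε1 : ε ≤ 1) (hεc : ε ≤ S.c ^ 2 / 4) (hεc' : ε ≤ S.c)
    (hεc'' : ε ≤ S.c ^ 5 / 4) (hle : S.spread ε P.2 ≤ S.spread ε P.1) :
    ∃ x', S.IsHalf P.1 x' ∧ S.Linked ε z (x', P.2) := by
  obtain ⟨x', h1, h2, h3, h4⟩ := h.adm_fst.exists_half h.adm_snd hε0 hε1 hεc hεc' hεc''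
    h.spread_fst h.lo_le h.le_hi
  obtain ⟨s1, s2⟩ := h.adm_fst.spread_half h2 h1 hε0 hε1 hεc hεc'
  have hc := S.c_pos
  refine ⟨x', h1, h2, h.adm_snd, h3, h4, ?_, ?_⟩
  · exact (mul_le_mul_of_nonneg_left s1 (by positivity)).trans h.spread_fst
  · exact (mul_le_mul_of_nonneg_left hle (by positivity)).trans s2

theorem Linked.step {z : ℝ} {P : MarkedCell T × MarkedCell T} (h : S.Linked ε z P)
    (hε0 : 0 < ε) (hε1 : ε ≤ 1) (hεc : ε ≤ S.c ^ 2 / 4) (hεc' : ε ≤ S.c)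
    (hεc'' : ε ≤ S.c ^ 5 / 4) :
    ∃ P', S.Linked ε z P' ∧
      ((S.IsHalf P.1 P'.1 ∧ P'.2 = P.2) ∨ (P'.1 = P.1 ∧ S.IsHalf P.2 P'.2)) := by
  rcases le_total (S.spread ε P.2) (S.spread ε P.1) with hle | hle
  · obtain ⟨x', h1, h2⟩ := h.step_fst hε0 hε1 hεc hεc' hεc'' hle
    exact ⟨_, h2, Or.inl ⟨h1, rfl⟩⟩
  · obtain ⟨x', h1, h2⟩ := h.swap.step_fst hε0 hε1 hεc hεc' hεc'' hle
    exact ⟨_, h2.swap, Or.inr ⟨rfl, h1⟩⟩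

/-- A sequence of admissible marked cells, each equal to the previous one or one of its halves,
with lengths tending to zero. -/
structure Descent (S : SplitTree T) (ε : ℝ) (u : ℕ → MarkedCell T) : Prop where
  adm : ∀ k, S.Adm ε (u k)
  step : ∀ k, u (k + 1) = u k ∨ S.IsHalf (u k) (u (k + 1))
  tendsto : Tendsto (fun k => S.len (u k).cell) atTop (nhds 0)

/-- `β` keeps relative distance at least `κ` from the endpoints of all cells on some branch
starting at `t₀`. -/
def Inner (S : SplitTree T) (κ : ℝ) (t₀ : T) (β : ℝ) : Prop :=
  ∃ W : Set T, t₀ ∈ W ∧ (∀ t ∈ W, S.L t ∈ W ∨ S.R t ∈ W) ∧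
    ∀ t ∈ W, S.lft t + κ * S.len t ≤ β ∧ β ≤ S.lft t + S.len t - κ * S.len t

theorem Descent.bounds {u : ℕ → MarkedCell T} (hu : S.Descent ε u) (k : ℕ) :
    S.lft (u k).cell ≤ S.lft (u (k + 1)).cell ∧
    S.lft (u (k + 1)).cell + S.len (u (k + 1)).cell ≤ S.lft (u k).cell + S.len (u k).cell := by
  rcases hu.step k with h | h
  · rw [h]; exact ⟨le_rfl, le_rfl⟩
  · have := h.bounds (hu.adm k).valid
    exact ⟨this.1, this.2.1⟩

theorem Descent.left_margin {u : ℕ → MarkedCell T} (hu : S.Descent ε u) (hε0 : 0 < ε) (k : ℕ) :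
    ∃ j, S.lft (u k).cell + S.c * ε * S.len (u k).cell ≤ S.lft (u j).cell := by
  have hc := S.c_pos
  have hkp := (hu.adm k).len_le_p
  have hk := S.len_pos _ (hu.adm k).valid
  have key : ∀ i, (S.lft (u (k + i)).cell = S.lft (u k).cell ∧ (u (k + i)).p = (u k).p) ∨
      S.lft (u k).cell + S.c * ε * (u k).p ≤ S.lft (u (k + i)).cell := by
    intro i
    induction i with
    | zero => exact Or.inl ⟨rfl, rfl⟩
    | succ i ih =>
      rw [← add_assoc]
      rcases ih with ⟨i1, i2⟩ | ih
      · rcases hu.step (k + i) with h | h | h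
        · rw [h]; exact Or.inl ⟨i1, i2⟩
        · left
          rw [h]
          exact ⟨(S.lft_L _ (hu.adm _).valid).trans i1, i2⟩
        · right
          rw [h]
          have h1 := S.lft_R _ (hu.adm (k + i)).valid
          have h2 := S.le_len_L _ (hu.adm (k + i)).valid
          have h3 := (hu.adm (k + i)).p_le
          rw [i2] at h3
          have h4 := mul_le_mul_of_nonneg_left h3 hc.le
          simp only [mR]
          linarith
      · exact Or.inr (ih.trans (hu.bounds _).1)
  have hpos : 0 < ε * (u k).p := mul_pos hε0 (hk.trans_le hkp)
  obtain ⟨j, hj1, hj2⟩ :=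
    ((hu.tendsto.eventually_lt_const hpos).and (eventually_ge_atTop k)).exists
  obtain ⟨i, rfl⟩ := Nat.exists_eq_add_of_le hj2
  rcases key i with ⟨_, h⟩ | h
  · have := (hu.adm (k + i)).p_le
    rw [h] at this
    linarith
  · have : S.c * ε * S.len (u k).cell ≤ S.c * ε * (u k).p := by gcongr
    exact ⟨k + i, by linarith⟩

theorem Descent.right_margin {u : ℕ → MarkedCell T} (hu : S.Descent ε u) (hε0 : 0 < ε) (k : ℕ) :
    ∃ j, S.lft (u j).cell + S.len (u j).cell ≤
      S.lft (u k).cell + S.len (u k).cell - S.c * ε * S.len (u k).cell := by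
  have hc := S.c_pos
  have hkp := (hu.adm k).len_le_q
  have hk := S.len_pos _ (hu.adm k).valid
  have key : ∀ i, (S.lft (u (k + i)).cell + S.len (u (k + i)).cell =
        S.lft (u k).cell + S.len (u k).cell ∧ (u (k + i)).q = (u k).q) ∨
      S.lft (u (k + i)).cell + S.len (u (k + i)).cell ≤
        S.lft (u k).cell + S.len (u k).cell - S.c * ε * (u k).q := by
    intro i
    induction i with
    | zero => exact Or.inl ⟨rfl, rfl⟩
    | succ i ih =>
      rw [← add_assoc]
      rcases ih with ⟨i1, i2⟩ | ih
      · have h1 := S.lft_R _ (hu.adm (k + i)).valid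
        have h1' := S.lft_L _ (hu.adm (k + i)).valid
        have h2 := S.le_len_R _ (hu.adm (k + i)).valid
        have h5 := S.len_add _ (hu.adm (k + i)).valid
        rcases hu.step (k + i) with h | h | h
        · rw [h]; exact Or.inl ⟨i1, i2⟩
        · right
          rw [h]
          have h3 := (hu.adm (k + i)).q_le
          rw [i2] at h3
          have h4 := mul_le_mul_of_nonneg_left h3 hc.le
          simp only [mL]
          linarith
        · left
          rw [h]
          refine ⟨?_, i2⟩
          simp only [mR]
          linarith
      · exact Or.inr ((hu.bounds _).2.trans ih)
  have hpos : 0 < ε * (u k).q := mul_pos hε0 (hk.trans_le hkp)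
  obtain ⟨j, hj1, hj2⟩ :=
    ((hu.tendsto.eventually_lt_const hpos).and (eventually_ge_atTop k)).exists
  obtain ⟨i, rfl⟩ := Nat.exists_eq_add_of_le hj2
  rcases key i with ⟨_, h⟩ | h
  · have := (hu.adm (k + i)).q_le
    rw [h] at this
    linarith
  · have : S.c * ε * S.len (u k).cell ≤ S.c * ε * (u k).q := by gcongr
    exact ⟨k + i, by linarith⟩

/-- A descent converges to a point that stays away from the endpoints of all its cells. -/
theorem Descent.exists_inner {u : ℕ → MarkedCell T} (hu : S.Descent ε u) (hε0 : 0 < ε) :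
    ∃ β, S.Inner (S.c * ε) (u 0).cell β ∧
      Tendsto (fun k => S.lft (u k).cell) atTop (nhds β) := by
  have hmono : Monotone fun k => S.lft (u k).cell := monotone_nat_of_le_succ fun k => (hu.bounds k).1
  have hanti : Antitone fun k => S.lft (u k).cell + S.len (u k).cell :=
    antitone_nat_of_succ_le fun k => (hu.bounds k).2
  have hbdd : BddAbove (Set.range fun k => S.lft (u k).cell) := by
    refine ⟨1, ?_⟩
    rintro _ ⟨k, rfl⟩
    have h1 := (hu.adm k).right_le
    have h2 := S.len_pos _ (hu.adm k).valid
    change S.lft (u k).cell ≤ 1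
    linarith
  have hlim := tendsto_atTop_ciSup hmono hbdd
  set β := ⨆ k, S.lft (u k).cell
  have hlim' : Tendsto (fun k => S.lft (u k).cell + S.len (u k).cell) atTop (nhds β) := by
    simpa using hlim.add hu.tendsto
  refine ⟨β, ⟨Set.range fun k => (u k).cell, ⟨0, rfl⟩, ?_, ?_⟩, hlim⟩
  · rintro _ ⟨k, rfl⟩
    by_contra hcon
    push Not at hcon
    have hconst : ∀ i, u (k + i) = u k := by
      intro i
      induction i with
      | zero => rfl
      | succ i ih =>
        rw [← add_assoc]
        rcases hu.step (k + i) with h | h | h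
        · rw [h, ih]
        · exact absurd ⟨k + i + 1, by simp only [h, ih, mL]⟩ hcon.1
        · exact absurd ⟨k + i + 1, by simp only [h, ih, mR]⟩ hcon.2
    have hk := S.len_pos _ (hu.adm k).valid
    obtain ⟨j, hj1, hj2⟩ :=
      ((hu.tendsto.eventually_lt_const hk).and (eventually_ge_atTop k)).exists
    obtain ⟨i, rfl⟩ := Nat.exists_eq_add_of_le hj2
    rw [hconst i] at hj1
    exact lt_irrefl _ hj1
  · rintro _ ⟨k, rfl⟩
    obtain ⟨i, hi⟩ := hu.left_margin hε0 k
    obtain ⟨j, hj⟩ := hu.right_margin hε0 k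
    exact ⟨hi.trans (hmono.ge_of_tendsto hlim i), (hanti.le_of_tendsto hlim' j).trans hj⟩

/-- Every number well inside `[0,1]` is a product of two points that stay away from the endpoints
of all the cells containing them. -/
theorem exists_mul_eq {t₀ : T} (hv : S.Valid t₀) (hlft : S.lft t₀ = 0) (hlen : S.len t₀ = 1)
    (hε0 : 0 < ε) (hε : ε ≤ S.c ^ 5 / 4) {z : ℝ} (hz1 : (ε / S.c) ^ 2 ≤ z)
    (hz2 : z ≤ (1 - ε / S.c) ^ 2) :
    ∃ e f, e * f = z ∧ S.Inner (S.c * ε) t₀ e ∧ S.Inner (S.c * ε) t₀ f := by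
  have hc := S.c_pos
  have hch := S.c_le_half hv
  have hεc : ε ≤ S.c ^ 2 / 4 := by
    have : S.c ^ 5 ≤ S.c ^ 2 := pow_le_pow_of_le_one hc.le (by linarith) (by norm_num)
    linarith
  have hεc' : ε ≤ S.c := by nlinarith
  have hε1 : ε ≤ 1 := by linarith
  have hεd : ε / S.c ≤ 1 := (div_le_one hc).mpr hεc'
  have hz0 : 0 < z := lt_of_lt_of_le (by positivity) hz1
  let x₀ : MarkedCell T := ⟨t₀, 1, 1⟩
  have hx₀ : S.Adm ε x₀ := by
    constructor <;> simp [x₀, hv, hlft, hlen, hε1]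
  have hx₀lo : S.lo ε x₀ ≤ ε / S.c := by
    have := hx₀.lo_le hε0 hε1 hεc'
    simpa [x₀, hlft] using this
  have hx₀hi : 1 - ε / S.c ≤ S.hi ε x₀ := by
    have := hx₀.le_hi hε0 hε1 hεc'
    simpa [x₀, hlft, hlen] using this
  have hspread : ∀ x, S.Adm ε x → 0 ≤ S.spread ε x := fun x hx => by
    have h1 := hx.le_hi_sub_lo hε0 hε1 hεc
    have h2 := mul_pos (half_pos hc) (S.len_pos _ hx.valid)
    exact div_nonneg (by linarith) (hx.hi_pos hε0 hε1 hεc hεc').le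
  have hstart : S.Linked ε z (x₀, x₀) := by
    have hlo0 := hx₀.lo_nonneg hε1 hεc'
    have hs := hspread _ hx₀
    have hs' : S.c ^ 2 / 2 * S.spread ε x₀ ≤ S.spread ε x₀ :=
      mul_le_of_le_one_left hs (by nlinarith)
    refine ⟨hx₀, hx₀, ?_, ?_, hs', hs'⟩
    · refine le_trans ?_ hz1
      rw [sq]
      exact mul_le_mul hx₀lo hx₀lo hlo0 (by positivity)
    · refine hz2.trans ?_
      rw [sq]
      exact mul_le_mul hx₀hi hx₀hi (by linarith) (hx₀.hi_pos hε0 hε1 hεc hεc').le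
  choose! g hg1 hg2 using fun P (hP : S.Linked ε z P) => hP.step hε0 hε1 hεc hεc' hε
  let w : ℕ → MarkedCell T × MarkedCell T := fun k => g^[k] (x₀, x₀)
  have hw : ∀ k, S.Linked ε z (w k) := by
    intro k
    induction k with
    | zero => exact hstart
    | succ k ih =>
      simp only [w, Function.iterate_succ_apply']
      exact hg1 _ ih
  have hstep : ∀ k, (S.IsHalf (w k).1 (w (k + 1)).1 ∧ (w (k + 1)).2 = (w k).2) ∨
      ((w (k + 1)).1 = (w k).1 ∧ S.IsHalf (w k).2 (w (k + 1)).2) := by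
    intro k
    simp only [w, Function.iterate_succ_apply']
    exact hg2 _ (hw k)
  have hprod : ∀ k, S.len (w k).1.cell * S.len (w k).2.cell ≤ (1 - S.c) ^ k := by
    intro k
    induction k with
    | zero => simp [w, x₀, hlen]
    | succ k ih =>
      have p1 := S.len_pos _ (hw k).adm_fst.valid
      have p2 := S.len_pos _ (hw k).adm_snd.valid
      have h1 : (1 - S.c) * (S.len (w k).1.cell * S.len (w k).2.cell) ≤ (1 - S.c) ^ (k + 1) := by
        rw [pow_succ, mul_comm ((1 - S.c) ^ k)]
        exact mul_le_mul_of_nonneg_left ih (by linarith)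
      refine le_trans ?_ h1
      rcases hstep k with ⟨h, h'⟩ | ⟨h', h⟩
      · rw [h']
        have := (h.bounds (hw k).adm_fst.valid).2.2.1
        nlinarith
      · rw [h']
        have := (h.bounds (hw k).adm_snd.valid).2.2.1
        nlinarith
  have hhi1 : ∀ x, S.Adm ε x → S.hi ε x ≤ 1 := fun x hx =>
    (hx.le_hi_le_right hε1 hεc').2.1.trans hx.right_le
  have hcmp : ∀ P, S.Linked ε z P → S.len P.1.cell ≤ 4 / (S.c ^ 3 * z) * S.len P.2.cell := by
    intro P hP
    have q1 := hP.adm_fst.hi_pos hε0 hε1 hεc hεc'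
    have q2 := hP.adm_snd.hi_pos hε0 hε1 hεc hεc'
    have r1 := hhi1 _ hP.adm_fst
    have r2 := hhi1 _ hP.adm_snd
    have l1 := S.len_pos _ hP.adm_fst.valid
    have l2 := S.len_pos _ hP.adm_snd.valid
    have s1 : S.c / 2 * S.len P.1.cell ≤ S.spread ε P.1 := by
      unfold spread
      rw [le_div_iff₀ q1]
      have := hP.adm_fst.le_hi_sub_lo hε0 hε1 hεc
      have h3 : 0 < S.c / 2 * S.len P.1.cell := by positivity
      nlinarith
    have hz' : z ≤ S.hi ε P.2 := by
      have := hP.le_hi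
      nlinarith
    have s2 : S.spread ε P.2 ≤ S.len P.2.cell / z := by
      unfold spread
      have b1 := (hP.adm_snd.lft_le_lo_le hε1 hεc').1
      have b2 := (hP.adm_snd.le_hi_le_right hε1 hεc').2.1
      gcongr
      linarith
    have s3 := hP.spread_fst
    have s4 : S.c ^ 2 / 2 * (S.c / 2 * S.len P.1.cell) ≤ S.len P.2.cell / z :=
      ((mul_le_mul_of_nonneg_left s1 (by positivity)).trans s3).trans s2
    rw [le_div_iff₀ hz0] at s4
    rw [div_mul_eq_mul_div, le_div_iff₀ (by positivity)]
    nlinarith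
  have htend : ∀ v : ℕ → ℝ, (∀ k, 0 ≤ v k) →
      (∀ k, v k ^ 2 ≤ 4 / (S.c ^ 3 * z) * (1 - S.c) ^ k) → Tendsto v atTop (nhds 0) := by
    intro v hv0 hv2
    have h1 : Tendsto (fun k => 4 / (S.c ^ 3 * z) * (1 - S.c) ^ k) atTop (nhds 0) := by
      simpa using (tendsto_pow_atTop_nhds_zero_of_lt_one (by linarith : 0 ≤ 1 - S.c)
        (by linarith)).const_mul (4 / (S.c ^ 3 * z))
    have h2 : Tendsto (fun k => v k ^ 2) atTop (nhds 0) :=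
      squeeze_zero (fun k => sq_nonneg _) hv2 h1
    have h3 := h2.sqrt
    simpa [Real.sqrt_sq (hv0 _)] using h3
  have hK : 0 < 4 / (S.c ^ 3 * z) := by positivity
  have d1 : S.Descent ε fun k => (w k).1 := by
    refine ⟨fun k => (hw k).adm_fst, fun k => ?_, htend _ (fun k => ?_) fun k => ?_⟩
    · rcases hstep k with h | h
      · exact Or.inr h.1
      · exact Or.inl h.1
    · exact (S.len_pos _ (hw k).adm_fst.valid).le
    · have p1 := S.len_pos _ (hw k).adm_fst.valid
      have := mul_le_mul_of_nonneg_left (hcmp _ (hw k)) p1.le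
      have := mul_le_mul_of_nonneg_left (hprod k) hK.le
      nlinarith
  have d2 : S.Descent ε fun k => (w k).2 := by
    refine ⟨fun k => (hw k).adm_snd, fun k => ?_, htend _ (fun k => ?_) fun k => ?_⟩
    · rcases hstep k with h | h
      · exact Or.inl h.2
      · exact Or.inr h.2
    · exact (S.len_pos _ (hw k).adm_snd.valid).le
    · have p1 := S.len_pos _ (hw k).adm_snd.valid
      have := mul_le_mul_of_nonneg_left (hcmp _ (hw k).swap) p1.le
      have := mul_le_mul_of_nonneg_left (hprod k) hK.le
      simp only [Prod.fst_swap, Prod.snd_swap] at *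
      nlinarith
  obtain ⟨e, he, hel⟩ := d1.exists_inner hε0
  obtain ⟨f, hf, hfl⟩ := d2.exists_inner hε0
  refine ⟨e, f, ?_, he, hf⟩
  have her : Tendsto (fun k => S.lft (w k).1.cell + S.len (w k).1.cell) atTop (nhds e) := by
    simpa using hel.add d1.tendsto
  have hfr : Tendsto (fun k => S.lft (w k).2.cell + S.len (w k).2.cell) atTop (nhds f) := by
    simpa using hfl.add d2.tendsto
  refine le_antisymm (le_of_tendsto (hel.mul hfl) (.of_forall fun k => ?_))
    (ge_of_tendsto (her.mul hfr) (.of_forall fun k => ?_))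
  · refine le_trans ?_ (hw k).lo_le
    exact mul_le_mul ((hw k).adm_fst.lft_le_lo_le hε1 hεc').1
      ((hw k).adm_snd.lft_le_lo_le hε1 hεc').1 (hw k).adm_snd.lft_nonneg
      ((hw k).adm_fst.lo_nonneg hε1 hεc')
  · refine (hw k).le_hi.trans ?_
    have := (hw k).adm_snd.hi_pos hε0 hε1 hεc hεc'
    refine mul_le_mul ((hw k).adm_fst.le_hi_le_right hε1 hεc').2.1
      ((hw k).adm_snd.le_hi_le_right hε1 hεc').2.1 this.le ?_
    exact add_nonneg (hw k).adm_fst.lft_nonneg (S.len_pos _ (hw k).adm_fst.valid).le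

end SplitTree

section NegativeContinuedFraction

variable {α : ℝ}

theorem ncq_succ (i : ℕ) : ncq α (i + 1) = npq α (i + 1) - (ncq α i)⁻¹ := by
  simp [ncq, npq]

theorem irrational_ncq (hirr : Irrational α) (i : ℕ) : Irrational (ncq α i) := by
  induction i with
  | zero => exact hirr
  | succ i ih => exact (irrational_inv_iff.mpr ih).intCast_sub _

theorem ncq_pos_lt_one (hirr : Irrational α) (h0 : 0 < α) (h1 : α < 1) (i : ℕ) :
    0 < ncq α i ∧ ncq α i < 1 := by
  cases i with
  | zero => exact ⟨h0, h1⟩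
  | succ i =>
    have hi := irrational_inv_iff.mpr (irrational_ncq hirr i)
    have h2 := Int.le_ceil (ncq α i)⁻¹
    have h3 := Int.ceil_lt_add_one (ncq α i)⁻¹
    have h4 := hi.ne_int ⌈(ncq α i)⁻¹⌉
    simp only [ncq]
    exact ⟨sub_pos.mpr (lt_of_le_of_ne h2 h4), by linarith⟩

theorem two_le_npq (hirr : Irrational α) (h0 : 0 < α) (h1 : α < 1) (i : ℕ) :
    2 ≤ npq α (i + 1) := by
  have h := ncq_pos_lt_one hirr h0 h1 i
  have : 1 < npq α (i + 1) := by
    simp only [npq, Nat.add_sub_cancel]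
    rw [Int.lt_ceil]
    simpa using (one_lt_inv₀ h.1).mpr h.2
  omega

theorem ncq_mul (hirr : Irrational α) (h0 : 0 < α) (h1 : α < 1) (i : ℕ) :
    ncq α i * (npq α (i + 1) - ncq α (i + 1)) = 1 := by
  have h := ncq_pos_lt_one hirr h0 h1 i
  rw [ncq_succ, sub_sub_cancel, mul_inv_cancel₀ h.1.ne']

theorem inv_one_sub_ncq_le (hirr : Irrational α) (h0 : 0 < α) (h1 : α < 1) {θ : ℝ} (hθ1 : θ ≤ 1)
    (hθ : ∀ i, ncq α i ≤ θ) (j : ℕ) :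
    ∀ i, (∃ k, i ≤ k ∧ k ≤ i + j ∧ npq α (k + 1) ≠ 2) →
      (1 - ncq α i)⁻¹ ≤ j + 1 + (2 - θ)⁻¹ := by
  have hθ2 : 0 < 2 - θ := by linarith
  have big : ∀ (j : ℕ) i, npq α (i + 1) ≠ 2 → (1 - ncq α i)⁻¹ ≤ j + 1 + (2 - θ)⁻¹ := by
    intro j i hi
    have ha : (3 : ℝ) ≤ npq α (i + 1) := by
      have := two_le_npq hirr h0 h1 i
      exact_mod_cast (show (3 : ℤ) ≤ npq α (i + 1) by omega)
    have hm := ncq_mul hirr h0 h1 i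
    have hp := ncq_pos_lt_one hirr h0 h1 i
    have hp' := ncq_pos_lt_one hirr h0 h1 (i + 1)
    have h3 : (1 - ncq α i)⁻¹ ≤ 1 + (2 - θ)⁻¹ := by
      have hle : ncq α i * (3 - θ) ≤ 1 := by
        have := hθ (i + 1)
        nlinarith
      rw [inv_le_iff_one_le_mul₀ (by linarith)]
      have : (1 + (2 - θ)⁻¹) = (3 - θ) * (2 - θ)⁻¹ := by field_simp; ring
      rw [this, ← div_eq_mul_inv, div_mul_eq_mul_div, le_div_iff₀ hθ2]
      nlinarith
    have : (0 : ℝ) ≤ j := j.cast_nonneg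
    linarith
  induction j with
  | zero =>
    rintro i ⟨k, hk1, hk2, hk3⟩
    obtain rfl : k = i := by omega
    exact big 0 k hk3
  | succ j ih =>
    rintro i ⟨k, hk1, hk2, hk3⟩
    by_cases hi : npq α (i + 1) = 2
    · have hk : k ≠ i := by rintro rfl; exact hk3 hi
      have h2 := ih (i + 1) ⟨k, by omega, by omega, hk3⟩
      have hm := ncq_mul hirr h0 h1 i
      have hp := ncq_pos_lt_one hirr h0 h1 i
      have hp' := ncq_pos_lt_one hirr h0 h1 (i + 1)
      rw [hi] at hm
      push_cast at hm ⊢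
      have : (1 - ncq α i)⁻¹ = 1 + (1 - ncq α (i + 1))⁻¹ := by
        have e1 : 1 - ncq α i ≠ 0 := by linarith
        have e2 : 1 - ncq α (i + 1) ≠ 0 := by linarith
        field_simp
        linarith
      rw [this]
      linarith
    · exact big _ i hi

theorem one_sub_inv_bound {y b : ℝ} (hy : y < 1) (h : (1 - y)⁻¹ ≤ b) : y ≤ 1 - b⁻¹ := by
  have hy' : 0 < 1 - y := by linarith
  have := inv_anti₀ (inv_pos.mpr hy') h
  rw [inv_inv] at this
  linarith

/-- The complete quotients are bounded away from `N / (N + 1)`. -/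
theorem exists_ncq_le (hirr : Irrational α) (h0 : 0 < α) (h1 : α < 1) {N : ℕ} (hN0 : 1 ≤ N)
    (hN : ∀ i, ∃ k, i ≤ k ∧ k < i + N ∧ npq α (k + 1) ≠ 2) :
    ∃ r : ℝ, 0 < r ∧ r < (N : ℝ) / (N + 1) ∧ ∀ i, ncq α i ≤ r := by
  have hN' : ∀ i, ∃ k, i ≤ k ∧ k ≤ i + (N - 1) ∧ npq α (k + 1) ≠ 2 := fun i => by
    obtain ⟨k, a, b, c⟩ := hN i
    exact ⟨k, a, by omega, c⟩
  have hcast : ((N - 1 : ℕ) : ℝ) + 1 = N := by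
    rw [Nat.cast_sub hN0]; push_cast; ring
  have hNpos : (0 : ℝ) < N := by exact_mod_cast hN0
  have b1 : ∀ i, ncq α i ≤ 1 - ((N : ℝ) + 1)⁻¹ := fun i => by
    have h := inv_one_sub_ncq_le hirr h0 h1 le_rfl
      (fun i => (ncq_pos_lt_one hirr h0 h1 i).2.le) (N - 1) i (hN' i)
    rw [hcast] at h
    norm_num at h
    exact one_sub_inv_bound (ncq_pos_lt_one hirr h0 h1 i).2 h
  set θ : ℝ := 1 - ((N : ℝ) + 1)⁻¹ with hθ
  have hinv : 0 < ((N : ℝ) + 1)⁻¹ := by positivity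
  have hθ1 : θ < 1 := by linarith
  have hlt : (2 - θ)⁻¹ < 1 := inv_lt_one_of_one_lt₀ (by linarith)
  have hpos : 0 < (2 - θ)⁻¹ := inv_pos.mpr (by linarith)
  have b2 : ∀ i, ncq α i ≤ 1 - ((N : ℝ) + (2 - θ)⁻¹)⁻¹ := fun i => by
    have h := inv_one_sub_ncq_le hirr h0 h1 hθ1.le b1 (N - 1) i (hN' i)
    rw [hcast] at h
    exact one_sub_inv_bound (ncq_pos_lt_one hirr h0 h1 i).2 h
  refine ⟨_, (ncq_pos_lt_one hirr h0 h1 0).1.trans_le (b2 0), ?_, b2⟩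
  have h3 : ((N : ℝ) + 1)⁻¹ < ((N : ℝ) + (2 - θ)⁻¹)⁻¹ :=
    inv_strictAnti₀ (by linarith) (by linarith)
  have h4 : (N : ℝ) / (N + 1) = 1 - ((N : ℝ) + 1)⁻¹ := by field_simp; ring
  rw [h4]
  linarith

theorem Dk_succ (n : ℕ) : Dk α (n + 1) = Dk α n * ncq α n := by
  simp [Dk, Finset.prod_range_succ]

theorem Dk_pos (hirr : Irrational α) (h0 : 0 < α) (h1 : α < 1) (n : ℕ) : 0 < Dk α n :=
  Finset.prod_pos fun i _ => (ncq_pos_lt_one hirr h0 h1 i).1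

theorem Dk_recurrence (hirr : Irrational α) (h0 : 0 < α) (h1 : α < 1) (n : ℕ) :
    Dk α n = npq α (n + 1) * Dk α (n + 1) - Dk α (n + 2) := by
  have := ncq_mul hirr h0 h1 n
  rw [Dk_succ (n + 1), Dk_succ n]
  linear_combination -Dk α n * this

/-- The first index `m ≥ n` with `a_{m+1} ≠ 2`. -/
noncomputable def nextBig (α : ℝ) (n : ℕ) : ℕ := sInf {m | n ≤ m ∧ npq α (m + 1) ≠ 2}

theorem nextBig_self {n : ℕ} (h : npq α (n + 1) ≠ 2) : nextBig α n = n := by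
  refine le_antisymm (Nat.sInf_le ⟨le_rfl, h⟩) ?_
  exact le_csInf ⟨n, le_rfl, h⟩ fun m hm => hm.1

theorem nextBig_succ {n : ℕ} (h : npq α (n + 1) = 2) : nextBig α (n + 1) = nextBig α n := by
  unfold nextBig
  congr 1
  ext m
  simp only [Set.mem_ofPred_eq]
  refine ⟨fun hm => ⟨by omega, hm.2⟩, fun hm => ⟨?_, hm.2⟩⟩
  have : m ≠ n := by rintro rfl; exact hm.2 h
  omega

theorem nextBig_spec {n : ℕ} (h : ∃ m, n ≤ m ∧ npq α (m + 1) ≠ 2) :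
    n ≤ nextBig α n ∧ npq α (nextBig α n + 1) ≠ 2 := Nat.sInf_mem h

theorem Dk_sub_nextBig (hirr : Irrational α) (h0 : 0 < α) (h1 : α < 1) (j : ℕ) :
    ∀ n, nextBig α n = n + j →
      Dk α n - Dk α (n + 1) = Dk α (nextBig α n) - Dk α (nextBig α n + 1) := by
  induction j with
  | zero => intro n hn; rw [hn]; rfl
  | succ j ih =>
    intro n hn
    have h2 : npq α (n + 1) = 2 := by
      by_contra h
      have := nextBig_self h
      omega
    rw [← nextBig_succ h2, ← ih (n + 1) (by rw [nextBig_succ h2, hn]; ring)]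
    have := Dk_recurrence hirr h0 h1 n
    rw [h2] at this
    push_cast at this
    linarith

end NegativeContinuedFraction

/-- Cells of the subdivision of `[0,1]` attached to the negative continued fraction of `α`,
with their left (for `body`, `full`) endpoint `v`:
* `full n v` is `[v, v + D_n]`;
* `top n v` is `[v + D_n - D_{n+1}, v + D_n]`;
* `body n k v` consists of `k + 1` intervals of length `D_{n+1}`
  followed by one of length `D_{n+1} - D_{n+2}`. -/
inductive NCell
  | full (n : ℕ) (v : ℝ)
  | top (n : ℕ) (v : ℝ)
  | body (n k : ℕ) (v : ℝ)

namespace NCell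

/-- The interval `[v, v + D_n - D_{n+1}]`. -/
noncomputable def bottom (α : ℝ) (n : ℕ) (v : ℝ) : NCell :=
  body (nextBig α n) (npq α (nextBig α n + 1) - 3).toNat v

/-- The cells arising in the subdivision. -/
def Valid (α : ℝ) : NCell → Prop
  | full _ _ => True
  | top _ _ => True
  | body n k _ => (k : ℤ) + 3 ≤ npq α (n + 1)

/-- Left endpoint. -/
noncomputable def lft (α : ℝ) : NCell → ℝ
  | full _ v => v
  | top n v => v + (Dk α n - Dk α (n + 1))
  | body _ _ v => v

/-- Length. -/
noncomputable def len (α : ℝ) : NCell → ℝ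
  | full n _ => Dk α n
  | top n _ => Dk α (n + 1)
  | body n k _ => (k + 2) * Dk α (n + 1) - Dk α (n + 2)

/-- Left half. -/
noncomputable def L (α : ℝ) : NCell → NCell
  | full n v => bottom α n v
  | top n v => top (n + 1) (v + (npq α (n + 1) - 2) * Dk α (n + 1))
  | body n _ v => full (n + 1) v

/-- Right half. -/
noncomputable def R (α : ℝ) : NCell → NCell
  | full n v => top n v
  | top n v => bottom α (n + 1) (v + (npq α (n + 1) - 1) * Dk α (n + 1))
  | body n 0 v => bottom α (n + 1) (v + Dk α (n + 1))
  | body n (k + 1) v => body n k (v + Dk α (n + 1))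

end NCell

section Cells

variable {α : ℝ}

theorem NCell.valid_bottom (hirr : Irrational α) (h0 : 0 < α) (h1 : α < 1)
    (hN : ∀ n, ∃ m, n ≤ m ∧ npq α (m + 1) ≠ 2) (n : ℕ) (v : ℝ) :
    NCell.Valid α (NCell.bottom α n v) := by
  have h2 := two_le_npq hirr h0 h1 (nextBig α n)
  have h3 := (nextBig_spec (hN n)).2
  simp only [NCell.bottom, NCell.Valid]
  omega

theorem NCell.lft_full (n : ℕ) (v : ℝ) : NCell.lft α (.full n v) = v := rfl

theorem NCell.lft_top (n : ℕ) (v : ℝ) :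
    NCell.lft α (.top n v) = v + (Dk α n - Dk α (n + 1)) := rfl

theorem NCell.lft_body (n k : ℕ) (v : ℝ) : NCell.lft α (.body n k v) = v := rfl

theorem NCell.len_full (n : ℕ) (v : ℝ) : NCell.len α (.full n v) = Dk α n := rfl

theorem NCell.len_top (n : ℕ) (v : ℝ) : NCell.len α (.top n v) = Dk α (n + 1) := rfl

theorem NCell.len_body (n k : ℕ) (v : ℝ) :
    NCell.len α (.body n k v) = (k + 2) * Dk α (n + 1) - Dk α (n + 2) := rfl

theorem NCell.lft_bottom (n : ℕ) (v : ℝ) : NCell.lft α (NCell.bottom α n v) = v := rfl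

theorem NCell.len_bottom (hirr : Irrational α) (h0 : 0 < α) (h1 : α < 1)
    (hN : ∀ n, ∃ m, n ≤ m ∧ npq α (m + 1) ≠ 2) (n : ℕ) (v : ℝ) :
    NCell.len α (NCell.bottom α n v) = Dk α n - Dk α (n + 1) := by
  have h2 := two_le_npq hirr h0 h1 (nextBig α n)
  obtain ⟨h4, h3⟩ := nextBig_spec (hN n)
  obtain ⟨j, hj⟩ := Nat.exists_eq_add_of_le h4
  rw [Dk_sub_nextBig hirr h0 h1 j n hj, Dk_recurrence hirr h0 h1 (nextBig α n)]
  have : (((npq α (nextBig α n + 1) - 3).toNat : ℤ) : ℝ) = npq α (nextBig α n + 1) - 3 := by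
    rw [Int.toNat_of_nonneg (by omega)]
    push_cast
    ring
  rw [Int.cast_natCast] at this
  simp only [NCell.bottom, NCell.len, this]
  ring

/-- The subdivision of `[0,1]` attached to the negative continued fraction of `α`. -/
noncomputable def ncfTree (hirr : Irrational α) (h0 : 0 < α) (h1 : α < 1)
    (hN : ∀ n, ∃ m, n ≤ m ∧ npq α (m + 1) ≠ 2) (M : ℕ) (hM : ∀ i, npq α (i + 1) ≤ (M : ℤ))
    (r : ℝ) (hr : ∀ i, ncq α i ≤ r) (hr1 : r < 1) : SplitTree NCell where
  Valid := NCell.Valid α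
  lft := NCell.lft α
  len := NCell.len α
  L := NCell.L α
  R := NCell.R α
  c := (1 - r) / M
  c_pos := by
    have := (two_le_npq hirr h0 h1 0).trans (hM 0)
    have : (0 : ℝ) < M := by exact_mod_cast (show 0 < M by omega)
    exact div_pos (by linarith) this
  valid_L := by
    rintro (⟨n, v⟩ | ⟨n, v⟩ | ⟨n, k, v⟩) hv
    · exact NCell.valid_bottom hirr h0 h1 hN n v
    · trivial
    · trivial
  valid_R := by
    rintro (⟨n, v⟩ | ⟨n, v⟩ | ⟨n, k, v⟩) hv
    · trivial
    · exact NCell.valid_bottom hirr h0 h1 hN _ _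
    · cases k with
      | zero => exact NCell.valid_bottom hirr h0 h1 hN _ _
      | succ k => simp only [NCell.Valid, NCell.R] at *; push_cast at hv; omega
  len_pos := by
    rintro (⟨n, v⟩ | ⟨n, v⟩ | ⟨n, k, v⟩) hv <;>
      simp only [NCell.len_full, NCell.len_top, NCell.len_body]
    · exact Dk_pos hirr h0 h1 n
    · exact Dk_pos hirr h0 h1 _
    · have a1 := Dk_pos hirr h0 h1 (n + 1)
      have a2 := ncq_pos_lt_one hirr h0 h1 (n + 1)
      have a3 : (0 : ℝ) ≤ k := k.cast_nonneg
      rw [Dk_succ (n + 1)]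
      nlinarith
  lft_L := by
    rintro (⟨n, v⟩ | ⟨n, v⟩ | ⟨n, k, v⟩) hv <;>
      simp only [NCell.L, NCell.lft_full, NCell.lft_top, NCell.lft_body, NCell.lft_bottom]
    have := Dk_recurrence hirr h0 h1 n
    linarith
  lft_R := by
    rintro (⟨n, v⟩ | ⟨n, v⟩ | ⟨n, k, v⟩) hv
    · simp only [NCell.R, NCell.L, NCell.len_bottom hirr h0 h1 hN, NCell.lft_full, NCell.lft_top]
    · simp only [NCell.R, NCell.L, NCell.len_top, NCell.lft_top, NCell.lft_bottom]
      have := Dk_recurrence hirr h0 h1 n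
      linarith
    · cases k <;> simp only [NCell.R, NCell.L, NCell.len_full, NCell.lft_body, NCell.lft_bottom]
  len_add := by
    rintro (⟨n, v⟩ | ⟨n, v⟩ | ⟨n, k, v⟩) hv
    · simp only [NCell.R, NCell.L, NCell.len_bottom hirr h0 h1 hN, NCell.len_full, NCell.len_top]
      ring
    · simp only [NCell.R, NCell.L, NCell.len_bottom hirr h0 h1 hN, NCell.len_top]
      ring
    · cases k with
      | zero =>
        simp only [NCell.R, NCell.L, NCell.len_bottom hirr h0 h1 hN, NCell.len_full, NCell.len_body]
        push_cast
        ring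
      | succ k =>
        simp only [NCell.R, NCell.L, NCell.len_full, NCell.len_body]
        push_cast
        ring
  le_len_L := by
    have hM0 : (0 : ℝ) < M := by
      have := (two_le_npq hirr h0 h1 0).trans (hM 0)
      exact_mod_cast (show 0 < M by omega)
    have hM1 : (1 : ℝ) ≤ M := by exact_mod_cast (show 0 < M by exact_mod_cast hM0)
    have hr0 : 0 < r := h0.trans_le (hr 0)
    rintro (⟨n, v⟩ | ⟨n, v⟩ | ⟨n, k, v⟩) hv
    · simp only [NCell.L, NCell.len_bottom hirr h0 h1 hN, NCell.len_full]
      have a1 := Dk_pos hirr h0 h1 n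
      rw [Dk_succ, div_mul_eq_mul_div, div_le_iff₀ hM0]
      have a2 := hr n
      have a3 : (1 - r) * Dk α n ≤ (1 - ncq α n) * Dk α n := by gcongr
      have a4 : 0 ≤ (1 - r) * Dk α n := mul_nonneg (by linarith) a1.le
      nlinarith
    · simp only [NCell.L, NCell.len_top]
      have a1 := Dk_pos hirr h0 h1 (n + 1)
      rw [Dk_succ (n + 1), div_mul_eq_mul_div, div_le_iff₀ hM0]
      have a2 := ncq_mul hirr h0 h1 (n + 1)
      have a3 := ncq_pos_lt_one hirr h0 h1 (n + 1)
      have a4 := ncq_pos_lt_one hirr h0 h1 (n + 2)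
      have a5 : (npq α (n + 1 + 1) : ℝ) ≤ M := by exact_mod_cast hM (n + 1)
      have a6 : 1 ≤ ncq α (n + 1) * M := by nlinarith
      nlinarith [mul_le_mul_of_nonneg_right a6 a1.le]
    · simp only [NCell.L, NCell.len_full, NCell.len_body]
      have a1 := Dk_pos hirr h0 h1 (n + 1)
      have a2 := Dk_pos hirr h0 h1 (n + 2)
      have a3 : (k : ℝ) + 3 ≤ M := by exact_mod_cast le_trans hv (hM n)
      rw [div_mul_eq_mul_div, div_le_iff₀ hM0]
      have a4 : (k + 2 : ℝ) * Dk α (n + 1) ≤ M * Dk α (n + 1) := by gcongr; linarith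
      have a5 : 0 ≤ M * Dk α (n + 1) := by positivity
      nlinarith
  le_len_R := by
    have hM0 : (0 : ℝ) < M := by
      have := (two_le_npq hirr h0 h1 0).trans (hM 0)
      exact_mod_cast (show 0 < M by omega)
    have hM1 : (1 : ℝ) ≤ M := by exact_mod_cast (show 0 < M by exact_mod_cast hM0)
    have hr0 : 0 < r := h0.trans_le (hr 0)
    rintro (⟨n, v⟩ | ⟨n, v⟩ | ⟨n, k, v⟩) hv
    · simp only [NCell.R, NCell.len_full, NCell.len_top]
      have a1 := Dk_pos hirr h0 h1 n
      rw [Dk_succ n, div_mul_eq_mul_div, div_le_iff₀ hM0]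
      have a2 := ncq_mul hirr h0 h1 n
      have a3 := ncq_pos_lt_one hirr h0 h1 n
      have a4 := ncq_pos_lt_one hirr h0 h1 (n + 1)
      have a5 : (npq α (n + 1) : ℝ) ≤ M := by exact_mod_cast hM n
      have a6 : 1 ≤ ncq α n * M := by nlinarith
      nlinarith [mul_le_mul_of_nonneg_right a6 a1.le]
    · simp only [NCell.R, NCell.len_bottom hirr h0 h1 hN, NCell.len_top]
      have a1 := Dk_pos hirr h0 h1 (n + 1)
      rw [Dk_succ (n + 1), div_mul_eq_mul_div, div_le_iff₀ hM0]
      have a2 := hr (n + 1)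
      have a3 : (1 - r) * Dk α (n + 1) ≤ (1 - ncq α (n + 1)) * Dk α (n + 1) := by gcongr
      have a4 : 0 ≤ (1 - r) * Dk α (n + 1) := mul_nonneg (by linarith) a1.le
      nlinarith
    · have hlen : NCell.len α (NCell.R α (NCell.body n k v)) =
          (k + 1) * Dk α (n + 1) - Dk α (n + 2) := by
        cases k with
        | zero =>
          simp only [NCell.R, NCell.len_bottom hirr h0 h1 hN]
          push_cast
          ring
        | succ k =>
          simp only [NCell.R, NCell.len_body]
          push_cast
          ring
      rw [hlen]
      simp only [NCell.len_body]
      have a1 := Dk_pos hirr h0 h1 (n + 1)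
      have a2 := Dk_pos hirr h0 h1 (n + 2)
      have a3 : (k : ℝ) + 3 ≤ M := by exact_mod_cast le_trans hv (hM n)
      have a7 : (0 : ℝ) ≤ k := k.cast_nonneg
      rw [div_mul_eq_mul_div, div_le_iff₀ hM0]
      have a4 : (k + 2 : ℝ) * Dk α (n + 1) - Dk α (n + 2) ≤ M * Dk α (n + 1) := by
        have : (k + 2 : ℝ) * Dk α (n + 1) ≤ M * Dk α (n + 1) := by gcongr; linarith
        linarith
      have a5 : (1 - r) * Dk α (n + 1) ≤ (k + 1) * Dk α (n + 1) - Dk α (n + 2) := by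
        rw [Dk_succ (n + 1)]
        have : (1 - r) * Dk α (n + 1) ≤ (1 - ncq α (n + 1)) * Dk α (n + 1) := by
          gcongr
          exact hr (n + 1)
        nlinarith
      have a6 := mul_le_mul_of_nonneg_left a4 (by linarith : 0 ≤ 1 - r)
      have a8 := mul_le_mul_of_nonneg_left a5 hM0.le
      linarith

theorem drem_nonneg {β : ℝ} (hβ : 0 ≤ β) (n : ℕ) : 0 ≤ drem α β n := by
  cases n with
  | zero => exact hβ
  | succ n => exact Int.fract_nonneg _

theorem drem_lt_one {β : ℝ} (hβ : β < 1) (n : ℕ) : drem α β n < 1 := by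
  cases n with
  | zero => exact hβ
  | succ n => exact Int.fract_lt_one _

theorem drem_eq (hirr : Irrational α) (h0 : 0 < α) (h1 : α < 1) (β : ℝ) (n : ℕ) :
    drem α β n = ncq α n * (db α β (n + 1) + drem α β (n + 1)) := by
  have h := ncq_pos_lt_one hirr h0 h1 n
  simp only [db, drem, Nat.add_sub_cancel, Int.floor_add_fract]
  rw [mul_div_cancel₀ _ h.1.ne']

theorem drem_le_pow (hirr : Irrational α) (h0 : 0 < α) (h1 : α < 1) {r : ℝ}
    (hr : ∀ i, ncq α i ≤ r) {β : ℝ} (hβ0 : 0 ≤ β) (hβ1 : β < 1) (m : ℕ) :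
    ∀ n, (∀ l, n < l → l ≤ n + m → db α β l = 0) → drem α β n ≤ r ^ m := by
  induction m with
  | zero => exact fun n _ => by simpa using (drem_lt_one hβ1 n).le
  | succ m ih =>
    intro n hn
    rw [drem_eq hirr h0 h1, hn (n + 1) (by omega) (by omega), Int.cast_zero, zero_add, pow_succ']
    exact mul_le_mul (hr n) (ih (n + 1) fun l h h' => hn l (by omega) (by omega))
      (drem_nonneg hβ0 _) (h0.le.trans (hr 0))

theorem abs_drem_sub_le_pow (hirr : Irrational α) (h0 : 0 < α) (h1 : α < 1) {r : ℝ}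
    (hr : ∀ i, ncq α i ≤ r) {β : ℝ} (hβ0 : 0 ≤ β) (hβ1 : β < 1) (m : ℕ) :
    ∀ n, (∀ l, n < l → l ≤ n + m → db α β l = npq α l - 2) →
      |drem α β n - (1 - ncq α n)| ≤ r ^ m := by
  induction m with
  | zero =>
    intro n _
    have a1 := drem_nonneg (α := α) hβ0 n
    have a2 := drem_lt_one (α := α) hβ1 n
    have a3 := ncq_pos_lt_one hirr h0 h1 n
    rw [pow_zero, abs_le]
    constructor <;> linarith
  | succ m ih =>
    intro n hn
    have e1 := drem_eq hirr h0 h1 β n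
    rw [hn (n + 1) (by omega) (by omega)] at e1
    push_cast at e1
    have e2 : drem α β n - (1 - ncq α n) =
        ncq α n * (drem α β (n + 1) - (1 - ncq α (n + 1))) := by
      linear_combination e1 + ncq_mul hirr h0 h1 n
    rw [e2, abs_mul, abs_of_pos (ncq_pos_lt_one hirr h0 h1 n).1, pow_succ']
    exact mul_le_mul (hr n) (ih (n + 1) fun l h h' => hn l (by omega) (by omega))
      (abs_nonneg _) (h0.le.trans (hr 0))

theorem mem_Eset_Fset (hirr : Irrational α) (h0 : 0 < α) (h1 : α < 1) {r : ℝ}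
    (hr : ∀ i, ncq α i ≤ r) (hr1 : r ≤ 1) {β : ℝ} (hβ0 : 0 ≤ β) (hβ1 : β < 1) {s : ℕ}
    (h : ∀ n, r ^ s < drem α β n ∧ r ^ s < |drem α β n - (1 - ncq α n)|) :
    β ∈ Eset α s ∧ β ∈ Fset α s := by
  have hzero : ∀ i : ℕ, 1 ≤ i → ∃ l : ℕ, i ≤ l ∧ l ≤ i + s ∧ db α β l ≠ 0 := by
    intro i hi
    by_contra! hc
    have a1 := drem_le_pow hirr h0 h1 hr hβ0 hβ1 (s + 1) (i - 1)
      fun l h h' => hc l (by omega) (by omega)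
    have a2 := pow_le_pow_of_le_one (h0.le.trans (hr 0)) hr1 (Nat.le_succ s)
    exact absurd (h (i - 1)).1 (not_lt.mpr (a1.trans a2))
  have htop : ∀ i : ℕ, ¬ ∀ l, i < l → l ≤ i + s → db α β l = npq α l - 2 := fun i hi =>
    absurd (h i).2 (not_lt.mpr (abs_drem_sub_le_pow hirr h0 h1 hr hβ0 hβ1 s i hi))
  exact ⟨⟨hβ0, hβ1, fun i hi => ⟨hzero i hi, fun hb =>
      htop (i - 1) fun l h h' => hb.1 l (by omega) (by omega)⟩⟩,
    ⟨hβ0, hβ1, fun i hi => ⟨hzero i hi, fun hb => htop i hb.2⟩⟩⟩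

theorem eq_add_drem_succ (hirr : Irrational α) (h0 : 0 < α) (h1 : α < 1) {β v : ℝ} {n : ℕ}
    (hβ : β = v + Dk α n * drem α β n) (j : ℤ) (hj : v + j * Dk α (n + 1) ≤ β)
    (hj' : β < v + j * Dk α (n + 1) + Dk α (n + 1)) :
    β = v + j * Dk α (n + 1) + Dk α (n + 1) * drem α β (n + 1) := by
  have hD := Dk_pos hirr h0 h1 (n + 1)
  have hx : β = v + Dk α (n + 1) * (drem α β n / ncq α n) := by
    rw [Dk_succ, mul_assoc, mul_div_cancel₀ _ (ncq_pos_lt_one hirr h0 h1 n).1.ne', ← hβ]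
  have hfl : ⌊drem α β n / ncq α n⌋ = j := by
    rw [Int.floor_eq_iff]
    constructor <;> nlinarith
  have : drem α β (n + 1) = drem α β n / ncq α n - j := by
    rw [drem, Int.fract, hfl]
  rw [this]
  linarith

/-- The branch `W` contains, for a suitable `v` with `β = v + D_n β_{n+1}`, one of the two halves
of the cell `full n v`. -/
def HitsLevel (α β : ℝ) (W : Set NCell) (n : ℕ) : Prop :=
  ∃ v, β = v + Dk α n * drem α β n ∧ (NCell.bottom α n v ∈ W ∨ NCell.top n v ∈ W)

theorem HitsLevel.of_full {β v : ℝ} {n : ℕ} {W : Set NCell}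
    (hW : ∀ t ∈ W, NCell.L α t ∈ W ∨ NCell.R α t ∈ W) (h : NCell.full n v ∈ W)
    (hβ : β = v + Dk α n * drem α β n) : HitsLevel α β W n :=
  ⟨v, hβ, hW _ h⟩

theorem HitsLevel.of_body (hirr : Irrational α) (h0 : 0 < α) (h1 : α < 1)
    (hN : ∀ n, ∃ m, n ≤ m ∧ npq α (m + 1) ≠ 2) {β κ v : ℝ} {n : ℕ} {W : Set NCell} (hκ0 : 0 < κ)
    (hW : ∀ t ∈ W, NCell.L α t ∈ W ∨ NCell.R α t ∈ W)
    (hb : ∀ t ∈ W, NCell.lft α t + κ * NCell.len α t ≤ β ∧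
      β ≤ NCell.lft α t + NCell.len α t - κ * NCell.len α t)
    (hβ : β = v + Dk α n * drem α β n) (k : ℕ) :
    ∀ j : ℤ, NCell.body n k (v + j * Dk α (n + 1)) ∈ W → HitsLevel α β W (n + 1) := by
  have hD := Dk_pos hirr h0 h1 (n + 1)
  have hD' := Dk_pos hirr h0 h1 (n + 2)
  have hfull : ∀ j : ℤ, NCell.full (n + 1) (v + j * Dk α (n + 1)) ∈ W →
      HitsLevel α β W (n + 1) := by
    intro j hj
    have hbj := hb _ hj
    simp only [NCell.lft_full, NCell.len_full] at hbj
    exact .of_full hW hj (eq_add_drem_succ hirr h0 h1 hβ j (by nlinarith) (by nlinarith))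
  induction k with
  | zero =>
    intro j hj
    rcases hW _ hj with h | h
    · exact hfull j h
    · simp only [NCell.R] at h
      have hbj := hb _ h
      have hlt : 0 < Dk α (n + 1) - Dk α (n + 2) := by
        have := ncq_pos_lt_one hirr h0 h1 (n + 1)
        rw [Dk_succ (n + 1)]
        nlinarith
      simp only [NCell.lft_bottom, NCell.len_bottom hirr h0 h1 hN] at hbj
      have hv : v + j * Dk α (n + 1) + Dk α (n + 1) = v + (j + 1 : ℤ) * Dk α (n + 1) := by
        push_cast
        ring
      rw [hv] at h hbj
      exact ⟨_, eq_add_drem_succ hirr h0 h1 hβ (j + 1) (by nlinarith) (by nlinarith), Or.inl h⟩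
  | succ k ih =>
    intro j hj
    rcases hW _ hj with h | h
    · exact hfull j h
    · refine ih (j + 1) ?_
      have hv : v + (j + 1 : ℤ) * Dk α (n + 1) = v + j * Dk α (n + 1) + Dk α (n + 1) := by
        push_cast
        ring
      rw [hv]
      exact h

theorem HitsLevel.all (hirr : Irrational α) (h0 : 0 < α) (h1 : α < 1)
    (hN : ∀ n, ∃ m, n ≤ m ∧ npq α (m + 1) ≠ 2) {β κ : ℝ} {W : Set NCell} (hκ0 : 0 < κ)
    (hroot : NCell.full 0 0 ∈ W)
    (hW : ∀ t ∈ W, NCell.L α t ∈ W ∨ NCell.R α t ∈ W)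
    (hb : ∀ t ∈ W, NCell.lft α t + κ * NCell.len α t ≤ β ∧
      β ≤ NCell.lft α t + NCell.len α t - κ * NCell.len α t) (n : ℕ) :
    HitsLevel α β W n := by
  induction n with
  | zero => exact .of_full hW hroot (by simp [Dk, drem])
  | succ n ih =>
    obtain ⟨v, hβ, h | h⟩ := ih
    · by_cases h2 : npq α (n + 1) = 2
      · have hbj := hb _ h
        simp only [NCell.lft_bottom, NCell.len_bottom hirr h0 h1 hN] at hbj
        have hrec := Dk_recurrence hirr h0 h1 n
        rw [h2, Int.cast_two] at hrec
        have hD := Dk_pos hirr h0 h1 (n + 1)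
        have hD' := Dk_pos hirr h0 h1 (n + 2)
        have hlt : 0 < Dk α n - Dk α (n + 1) := by
          have := ncq_pos_lt_one hirr h0 h1 n
          have := Dk_pos hirr h0 h1 n
          rw [Dk_succ n]
          nlinarith
        refine ⟨v, ?_, Or.inl ?_⟩
        · simpa using eq_add_drem_succ hirr h0 h1 hβ 0 (by push_cast; nlinarith)
            (by push_cast; nlinarith)
        · rwa [NCell.bottom, nextBig_succ h2]
      · rw [NCell.bottom, nextBig_self h2] at h
        exact .of_body hirr h0 h1 hN hκ0 hW hb hβ _ 0 (by simpa using h)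
    · have hrec := Dk_recurrence hirr h0 h1 n
      have hD := Dk_pos hirr h0 h1 (n + 1)
      have hD' := Dk_pos hirr h0 h1 (n + 2)
      have hlt : 0 < Dk α (n + 1) - Dk α (n + 2) := by
        have := ncq_pos_lt_one hirr h0 h1 (n + 1)
        rw [Dk_succ (n + 1)]
        nlinarith
      rcases hW _ h with h | h <;> have hbj := hb _ h
      · simp only [NCell.L, NCell.lft_top, NCell.len_top] at h hbj
        refine ⟨_, ?_, Or.inr h⟩
        have := eq_add_drem_succ hirr h0 h1 hβ (npq α (n + 1) - 2) (by push_cast; nlinarith)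
          (by push_cast; nlinarith)
        push_cast at this
        exact this
      · simp only [NCell.R, NCell.lft_bottom, NCell.len_bottom hirr h0 h1 hN] at h hbj
        refine ⟨_, ?_, Or.inl h⟩
        have := eq_add_drem_succ hirr h0 h1 hβ (npq α (n + 1) - 1) (by push_cast; nlinarith)
          (by push_cast; nlinarith)
        push_cast at this
        exact this

theorem HitsLevel.margin (hirr : Irrational α) (h0 : 0 < α) (h1 : α < 1)
    (hN : ∀ n, ∃ m, n ≤ m ∧ npq α (m + 1) ≠ 2) {β κ : ℝ} {W : Set NCell} (hκ0 : 0 < κ)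
    (hκ1 : κ ≤ 1)
    (hb : ∀ t ∈ W, NCell.lft α t + κ * NCell.len α t ≤ β ∧
      β ≤ NCell.lft α t + NCell.len α t - κ * NCell.len α t) {n : ℕ}
    (h : HitsLevel α β W n) {c : ℝ} (hc : c ≤ ncq α n) (hc' : c ≤ 1 - ncq α n) :
    κ * c ≤ drem α β n ∧ κ * c ≤ |drem α β n - (1 - ncq α n)| := by
  obtain ⟨v, hβ, h⟩ := h
  have hD := Dk_pos hirr h0 h1 n
  have ha := ncq_pos_lt_one hirr h0 h1 n
  have k1 := mul_le_mul_of_nonneg_left hc hκ0.le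
  have k2 := mul_le_mul_of_nonneg_left hc' hκ0.le
  have k3 : κ * (1 - ncq α n) ≤ 1 * (1 - ncq α n) := by gcongr; linarith
  have key : ∀ {x y : ℝ}, Dk α n * x ≤ Dk α n * y → x ≤ y := fun h => le_of_mul_le_mul_left h hD
  rcases h with h | h <;> have hbj := hb _ h
  · simp only [NCell.lft_bottom, NCell.len_bottom hirr h0 h1 hN, Dk_succ] at hbj
    have b1 : κ * (1 - ncq α n) ≤ drem α β n := key (by linarith)
    have b2 : drem α β n ≤ (1 - κ) * (1 - ncq α n) := key (by linarith)
    refine ⟨by linarith, le_trans ?_ (neg_le_abs _)⟩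
    linarith
  · simp only [NCell.lft_top, NCell.len_top, Dk_succ] at hbj
    have b1 : 1 - ncq α n + κ * ncq α n ≤ drem α β n := key (by linarith)
    refine ⟨by nlinarith, le_trans ?_ (le_abs_self _)⟩
    linarith

/-- Points that stay away from the endpoints of all cells along a branch have restricted
Davenport expansions. -/
theorem mem_Eset_Fset_of_inner (hirr : Irrational α) (h0 : 0 < α) (h1 : α < 1)
    (hN : ∀ n, ∃ m, n ≤ m ∧ npq α (m + 1) ≠ 2) {M : ℕ} (hM : ∀ i, npq α (i + 1) ≤ (M : ℤ))
    {r : ℝ} (hr : ∀ i, ncq α i ≤ r) (hr1 : r < 1) {κ : ℝ} (hκ0 : 0 < κ) (hκ1 : κ ≤ 1) {s : ℕ}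
    (hs : r ^ s < κ * ((1 - r) / M)) {β : ℝ}
    (hβ : (ncfTree hirr h0 h1 hN M hM r hr hr1).Inner κ (.full 0 0) β) :
    β ∈ Eset α s ∧ β ∈ Fset α s := by
  obtain ⟨W, hroot, hW, hb⟩ := hβ
  have hM0 : (0 : ℝ) < M := by
    have := (two_le_npq hirr h0 h1 0).trans (hM 0)
    exact_mod_cast (show 0 < M by omega)
  have hM1 : (1 : ℝ) ≤ M := by exact_mod_cast (show 0 < M by exact_mod_cast hM0)
  have hr0 : 0 < r := h0.trans_le (hr 0)
  have hb0 : 0 + κ * Dk α 0 ≤ β ∧ β ≤ 0 + Dk α 0 - κ * Dk α 0 := hb _ hroot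
  simp only [Dk, Finset.range_zero, Finset.prod_empty] at hb0
  refine mem_Eset_Fset hirr h0 h1 hr hr1.le (by linarith) (by linarith) fun n => ?_
  have hc : (1 - r) / M ≤ ncq α n := by
    have a2 := ncq_mul hirr h0 h1 n
    have a3 := ncq_pos_lt_one hirr h0 h1 n
    have a4 := ncq_pos_lt_one hirr h0 h1 (n + 1)
    have a5 : (npq α (n + 1) : ℝ) ≤ M := by exact_mod_cast hM n
    rw [div_le_iff₀ hM0]
    nlinarith
  have hc' : (1 - r) / M ≤ 1 - ncq α n :=
    (div_le_self (by linarith) hM1).trans (by linarith [hr n])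
  have h := (HitsLevel.all hirr h0 h1 hN hκ0 hroot hW hb n).margin hirr h0 h1 hN hκ0 hκ1 hb
    hc hc'
  exact ⟨hs.trans_le h.1, hs.trans_le h.2⟩

end Cells

/-- Under the bounded-partial-quotient hypotheses, with `R = N/(N+1)`,
there is `s₀ ≥ N` such that for every `s ≥ s₀`, setting `P₁ = R^{2s}/(1 − R^{s−N})²` and
`P₂ = 1 − R^{s−N}`, one has `P₁ ≤ P₂` and `[P₁, P₂] ⊆ E(α,s)·F(α,s)`. -/
theorem stmt19 (α : ℝ) (hirr : Irrational α) (h0 : 0 < α) (h1 : α < 1)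
    (M N : ℕ) (hM0 : 0 < M) (hN0 : 1 ≤ N)
    (hM : ∀ i : ℕ, 1 ≤ i → npq α i ≤ (M : ℤ))
    (hN : ¬ ∃ i : ℕ, 1 ≤ i ∧ ∀ k : ℕ, i ≤ k → k < i + N → npq α k = 2)
    (R : ℝ) (hR : R = (N : ℝ) / ((N : ℝ) + 1)) :
    ∃ s₀ : ℕ, N ≤ s₀ ∧ ∀ s : ℕ, s₀ ≤ s →
      R ^ (2 * s) / (1 - R ^ (s - N)) ^ 2 ≤ 1 - R ^ (s - N) ∧
      Set.Icc (R ^ (2 * s) / (1 - R ^ (s - N)) ^ 2) (1 - R ^ (s - N)) ⊆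
        {x : ℝ | ∃ e ∈ Eset α s, ∃ f ∈ Fset α s, x = e * f} := by
  have hN1 : ∀ i, ∃ k, i ≤ k ∧ k < i + N ∧ npq α (k + 1) ≠ 2 := by
    intro i
    by_contra! hc
    refine hN ⟨i + 1, by omega, fun k hk hk' => ?_⟩
    obtain ⟨m, rfl⟩ : ∃ m, k = m + 1 := ⟨k - 1, by omega⟩
    exact hc m (by omega) (by omega)
  have hN2 : ∀ n, ∃ m, n ≤ m ∧ npq α (m + 1) ≠ 2 := fun n => by
    obtain ⟨k, a, -, b⟩ := hN1 n
    exact ⟨k, a, b⟩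
  have hM1 : ∀ i, npq α (i + 1) ≤ (M : ℤ) := fun i => hM (i + 1) (by omega)
  obtain ⟨r, hr0, hrR, hr⟩ := exists_ncq_le hirr h0 h1 hN0 hN1
  rw [← hR] at hrR
  have hR0 : 0 < R := hr0.trans hrR
  have hR1 : R < 1 := by
    rw [hR, div_lt_one (by positivity)]
    linarith
  have hr1 : r < 1 := hrR.trans hR1
  set S := ncfTree hirr h0 h1 hN2 M hM1 r hr hr1 with hS
  set c : ℝ := (1 - r) / M with hc
  have hcS : S.c = c := rfl
  have hM0' : (0 : ℝ) < M := by exact_mod_cast hM0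
  have hM1' : (1 : ℝ) ≤ M := by exact_mod_cast hM0
  have hc0 : 0 < c := div_pos (by linarith) hM0'
  have hc1 : c ≤ 1 := (div_le_self (by linarith) hM1').trans (by linarith)
  have hRt : Tendsto (fun s : ℕ => R ^ s) atTop (nhds 0) :=
    tendsto_pow_atTop_nhds_zero_of_lt_one hR0.le hR1
  have ev1 : ∀ᶠ s : ℕ in atTop, r ^ s < c * (c * R ^ s / 2) * c := by
    have h1 : Tendsto (fun s : ℕ => (r / R) ^ s) atTop (nhds 0) :=
      tendsto_pow_atTop_nhds_zero_of_lt_one (by positivity) ((div_lt_one hR0).mpr hrR)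
    filter_upwards [h1.eventually_lt_const (show 0 < c ^ 3 / 2 by positivity)] with s hs
    rw [div_pow, div_lt_iff₀ (by positivity)] at hs
    linarith
  have ev2 : ∀ᶠ s : ℕ in atTop, R ^ s < c ^ 4 / 2 := hRt.eventually_lt_const (by positivity)
  have ev3 : ∀ᶠ s : ℕ in atTop, R ^ (s - N) < 1 / 4 :=
    ((tendsto_sub_atTop_nat N).eventually (hRt.eventually_lt_const (by norm_num)))
  obtain ⟨s₀, hs₀⟩ := eventually_atTop.mp (ev1.and (ev2.and ev3))
  refine ⟨max N s₀, le_max_left _ _, fun s hs => ?_⟩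
  obtain ⟨b1, b2, b3⟩ := hs₀ s ((le_max_right _ _).trans hs)
  have hx0 : 0 < R ^ s := by positivity
  have hy0 : 0 < R ^ (s - N) := by positivity
  have hxy : R ^ s ≤ R ^ (s - N) := pow_le_pow_of_le_one hR0.le hR1.le (Nat.sub_le _ _)
  have hsq : R ^ (2 * s) = (R ^ s) ^ 2 := by rw [← pow_mul, mul_comm]
  rw [hsq]
  set x := R ^ s
  set y := R ^ (s - N)
  have hy2 : 0 < (1 - y) ^ 2 := by nlinarith
  refine ⟨?_, ?_⟩
  · rw [div_le_iff₀ hy2]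
    have a1 : x ^ 2 ≤ (1 / 4) ^ 2 := by gcongr; linarith
    have a2 : (3 / 4 : ℝ) ^ 3 ≤ (1 - y) ^ 3 := by gcongr; linarith
    have a3 : (1 - y) * (1 - y) ^ 2 = (1 - y) ^ 3 := by ring
    rw [a3]
    norm_num at a1 a2 ⊢
    linarith
  · rintro z ⟨hz1, hz2⟩
    have hε0 : 0 < c * x / 2 := by positivity
    have hεc : c * x / 2 / c = x / 2 := by field_simp
    have hP : x ^ 2 ≤ x ^ 2 / (1 - y) ^ 2 := le_div_self (by positivity) hy2 (by nlinarith)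
    obtain ⟨e, f, hef, he, hf⟩ := S.exists_mul_eq (ε := c * x / 2) (t₀ := .full 0 0) (z := z)
      trivial rfl (by simp [hS, ncfTree, NCell.len_full, Dk]) hε0
      (by rw [hcS]; nlinarith)
      (by rw [hcS, hεc]; nlinarith)
      (by rw [hcS, hεc]; nlinarith)
    rw [hcS] at he hf
    have hκ0 : 0 < c * (c * x / 2) := by positivity
    have hκ1 : c * (c * x / 2) ≤ 1 := by
      have : c * (c * x / 2) ≤ 1 * (1 * 1 / 2) := by
        gcongr
        linarith
      linarith
    exact ⟨e, (mem_Eset_Fset_of_inner hirr h0 h1 hN2 hM1 hr hr1 hκ0 hκ1 b1 he).1,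
      f, (mem_Eset_Fset_of_inner hirr h0 h1 hN2 hM1 hr hr1 hκ0 hκ1 b1 hf).2, hef.symm⟩
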